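/- arXiv:0910.1064 — 3 statements merged into one kernel-verified Lean document; each statement's English description precedes it below -/
import Mathlib

section
/- Let H be a bipartite graph with no isolated vertices, and set s := s(H), t := t(H). For every α ∈ (0,1) and every ε > 0 there exists n₀ = n₀(s,t,α,ε) such that for every n ≥ n₀, every graph G on n vertices with at least T_{s,t}(α)·C(n,2) edges contains more than (1−ε)·(α/(s+t))·n pairwise vertex-disjoint copies of H. -/
/-- `G` contains `k` pairwise vertex-disjoint copies of `H`. -/
def HasTiling {α β : Type*} (H : SimpleGraph α) (G : SimpleGraph β) (k : ℕ) : Prop :=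
  ∃ f : Fin k → α → β,
    (∀ i, Function.Injective (f i)) ∧
    (∀ i u v, H.Adj u v → G.Adj (f i u) (f i v)) ∧
    (∀ i j : Fin k, i ≠ j → ∀ u v, f i u ≠ f j v)

/-- The threshold function
`T_{s,t}(α) = max{ (2sα/(s+t))·(1 - sα/(2(s+t))), α² }`. -/
noncomputable def Tst (s t : ℕ) (α : ℝ) : ℝ :=
  max ((2 * s * α / (s + t)) * (1 - s * α / (2 * (s + t)))) (α ^ 2)

namespace Tiling
open Finset

lemma card_noninj_le {V : Type} [DecidableEq V] (A : Finset V) (s : ℕ) :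
    #{g ∈ Fintype.piFinset (fun _ : Fin s => A) | ¬ Function.Injective g} * #A ≤ s ^ 2 * #A ^ s := by
  classical
  have key : ∀ i j : Fin s, i ≠ j →
      #{g ∈ Fintype.piFinset (fun _ : Fin s => A) | g i = g j} ≤ #A ^ (s - 1) := by
    intro i j hij
    have : #(Fintype.piFinset (fun _ : {x : Fin s // x ≠ j} => A)) = #A ^ (s - 1) := by
      rw [Fintype.card_piFinset]; simp
    rw [← this]
    apply Finset.card_le_card_of_injOn (fun g x => g x.1)
    · intro g hg
      have hg' := (mem_filter.1 (mem_coe.1 hg)).1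
      rw [Fintype.mem_piFinset] at hg'
      exact mem_coe.2 (Fintype.mem_piFinset.2 fun x => hg' x.1)
    · intro g hg g' hg' h
      replace hg := mem_filter.1 (mem_coe.1 hg)
      replace hg' := mem_filter.1 (mem_coe.1 hg')
      have h' : ∀ x, x ≠ j → g x = g' x := fun x hx => congrFun h ⟨x, hx⟩
      funext x
      by_cases hx : x = j
      · subst hx; rw [← hg.2, ← hg'.2]; exact h' i hij
      · exact h' x hx
  have h1 : #{g ∈ Fintype.piFinset (fun _ : Fin s => A) | ¬ Function.Injective g}
      ≤ s ^ 2 * #A ^ (s - 1) := by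
    calc _ ≤ #((univ : Finset (Fin s)).offDiag.biUnion fun p =>
            {g ∈ Fintype.piFinset (fun _ : Fin s => A) | g p.1 = g p.2}) := by
          apply card_le_card
          intro g hg
          simp only [mem_filter, Function.Injective, not_forall] at hg
          obtain ⟨hg, i, j, h, hij⟩ := hg
          simp only [mem_biUnion, mem_filter]
          exact ⟨(i, j), by simp [hij], hg, h⟩
      _ ≤ #((univ : Finset (Fin s)).offDiag) * #A ^ (s - 1) := by
          apply card_biUnion_le_card_mul
          intro p hp
          exact key p.1 p.2 (by simpa using hp)
      _ ≤ _ := by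
          gcongr
          rw [offDiag_card]; simp [sq]
  rcases Nat.eq_zero_or_pos s with rfl | hs
  · simp at h1 ⊢
    left
    intro g a b; exact a.elim0
  · calc _ ≤ s ^ 2 * #A ^ (s - 1) * #A := by gcongr
      _ = _ := by rw [mul_assoc, ← pow_succ, Nat.sub_add_cancel hs]

lemma kst (s t : ℕ) (hs : 0 < s) (d : ℝ) (hd : 0 < d) : ∃ N : ℕ, ∀ (V : Type) [Fintype V] [DecidableEq V]
    (G : SimpleGraph V) [DecidableRel G.Adj] (A B : Finset V), N ≤ #A → N ≤ #B →
    d ≤ (G.edgeDensity A B : ℝ) →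
    ∃ g : Fin s → V, ∃ h : Fin t → V, Function.Injective g ∧ Function.Injective h ∧
      (∀ i, g i ∈ A) ∧ (∀ j, h j ∈ B) ∧ ∀ i j, G.Adj (g i) (h j) := by
  obtain ⟨N, hN⟩ := exists_nat_gt (((t : ℝ) + s ^ 2) / d ^ s)
  refine ⟨N + 1, ?_⟩
  intro V _ _ G _ A B hA hB hAB
  by_contra hcon
  have hA0 : (0:ℝ) < #A := by exact_mod_cast (by omega : 0 < #A)
  have hB0 : (0:ℝ) < #B := by exact_mod_cast (by omega : 0 < #B)
  set deg : V → ℝ := fun b => (#{a ∈ A | G.Adj a b} : ℝ) with hdeg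
  have hsum : d * #A * #B ≤ ∑ b ∈ B, deg b := by
    have h1 : ((G.edgeDensity A B : ℚ) : ℝ) = (#(G.interedges A B) : ℝ) / (#A * #B) := by
      rw [SimpleGraph.edgeDensity_def]; push_cast; rfl
    have h2 : #(G.interedges A B) = ∑ b ∈ B, #{a ∈ A | G.Adj a b} := by
      rw [SimpleGraph.interedges, Rel.interedges, card_filter, sum_product_right]
      simp only [card_filter]
    rw [h1, le_div_iff₀ (by positivity)] at hAB
    rw [h2] at hAB
    push_cast at hAB
    linarith
  have hpow : (#B : ℝ) * (d * #A) ^ s ≤ ∑ b ∈ B, deg b ^ s := by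
    obtain ⟨m, rfl⟩ : ∃ m, s = m + 1 := ⟨s - 1, by omega⟩
    refine le_trans ?_ (pow_sum_div_card_le_sum_pow (f := deg) (s := B) (fun i _ => by positivity) m)
    rw [le_div_iff₀ (by positivity)]
    calc _ = (d * #A * #B) ^ (m + 1) := by ring
      _ ≤ _ := by gcongr
  have hcount : ∑ b ∈ B, deg b ^ s = ∑ g ∈ Fintype.piFinset (fun _ : Fin s => A),
      (#{b ∈ B | ∀ i, G.Adj (g i) b} : ℝ) := by
    have := sum_card_bipartiteAbove_eq_sum_card_bipartiteBelow
      (s := Fintype.piFinset (fun _ : Fin s => A)) (t := B)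
      (fun g b => ∀ i, G.Adj (g i) b)
    rw [← Nat.cast_sum]
    unfold bipartiteAbove bipartiteBelow at this
    rw [this]
    push_cast
    apply sum_congr rfl
    intro b hb
    rw [hdeg]
    have h3 : {a ∈ Fintype.piFinset (fun _ : Fin s => A) | ∀ i, G.Adj (a i) b}
       = Fintype.piFinset (fun _ : Fin s => {a ∈ A | G.Adj a b}) := by
      ext g; simp [forall_and]
    rw [h3, Fintype.card_piFinset]; simp
  have hle : ∑ g ∈ Fintype.piFinset (fun _ : Fin s => A),
      (#{b ∈ B | ∀ i, G.Adj (g i) b} : ℝ) ≤ 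
      #{g ∈ Fintype.piFinset (fun _ : Fin s => A) | ¬ Function.Injective g} * #B + #A ^ s * t := by
    rw [← sum_filter_add_sum_filter_not _ (fun g => ¬ Function.Injective g)]
    apply add_le_add
    · rw [← nsmul_eq_mul]
      apply sum_le_card_nsmul
      intro g hg
      exact_mod_cast card_filter_le _ _
    · have : (#{g ∈ Fintype.piFinset (fun _ : Fin s => A) | ¬ ¬ Function.Injective g} : ℝ) ≤ #A ^ s := by
        have := card_filter_le (Fintype.piFinset (fun _ : Fin s => A)) (fun g => ¬ ¬ Function.Injective g)
        rw [Fintype.card_piFinset] at this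
        simp only [prod_const, card_univ, Fintype.card_fin] at this
        exact_mod_cast this
      refine le_trans ?_ (mul_le_mul_of_nonneg_right this (by positivity))
      rw [← nsmul_eq_mul]
      apply sum_le_card_nsmul
      intro g hg
      simp only [mem_filter, not_not, Fintype.mem_piFinset] at hg
      by_contra hlt
      push Not at hlt
      have hlt' : t ≤ #{b ∈ B | ∀ i, G.Adj (g i) b} := by exact_mod_cast hlt.le
      obtain ⟨C, hC, hCt⟩ := exists_subset_card_eq hlt'
      let e := (C.equivFinOfCardEq hCt).symm
      refine hcon ⟨g, fun j => (e j).1, hg.2, fun x y hxy => e.injective (Subtype.ext hxy), hg.1, ?_, ?_⟩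
      · intro j
        have := hC (e j).2
        simp only [mem_filter] at this
        exact this.1
      · intro i j
        have := hC (e j).2
        simp only [mem_filter] at this
        exact this.2 i
  have hni : (#{g ∈ Fintype.piFinset (fun _ : Fin s => A) | ¬ Function.Injective g} : ℝ) * #A
      ≤ s ^ 2 * #A ^ s := by exact_mod_cast card_noninj_le A s
  have hfin : (#B : ℝ) * (d * #A) ^ s ≤ 
     #{g ∈ Fintype.piFinset (fun _ : Fin s => A) | ¬ Function.Injective g} * #B + #A ^ s * t := by
    linarith
  have hq := mul_le_mul_of_nonneg_right hfin hA0.le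
  have hq2 : (#B : ℝ) * #A * d ^ s * #A ^ s ≤ (s ^ 2 * #B + t * #A) * #A ^ s := by
    have := mul_le_mul_of_nonneg_right hni hB0.le
    rw [mul_pow] at hq
    nlinarith
  have hq3 : (#B : ℝ) * #A * d ^ s ≤ (s ^ 2 * #B + t * #A) := 
    le_of_mul_le_mul_right hq2 (by positivity)
  have hd' : 0 < d ^ s := by positivity
  rw [div_lt_iff₀ hd'] at hN
  have hNA : (N : ℝ) + 1 ≤ #A := by exact_mod_cast hA
  have hNB : (N : ℝ) + 1 ≤ #B := by exact_mod_cast hB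
  set D := d ^ s
  have e2 : (t + (s:ℝ) ^ 2) < #B * D := by nlinarith
  have e3 : (t + (s:ℝ) ^ 2) < #A * D := by nlinarith
  have hs0 : (0:ℝ) ≤ (s:ℝ)^2 := by positivity
  have ht0 : (0:ℝ) ≤ t := by positivity
  -- wlog split the product
  rcases le_total (#A : ℝ) #B with h | h
  · nlinarith [mul_le_mul_of_nonneg_left h ht0]
  · nlinarith [mul_le_mul_of_nonneg_left h hs0]

lemma exists_theta {ι : Type*} [Fintype ι] (g a β : ι → ℝ) (X : ℝ)
    (hg0 : ∀ i, 0 ≤ g i) (hg1 : ∀ i, g i ≤ 1) (hX : ∑ i, (a i + β i * g i) ≤ X) :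
    ∃ θ : ℝ, 0 < θ ∧ θ ≤ 1 ∧ ∑ i, (a i + β i * (if θ ≤ g i then 1 else 0)) ≤ X := by
  classical
  let μ : MeasureTheory.Measure ℝ := MeasureTheory.volume.restrict (Set.Ioc 0 1)
  have : MeasureTheory.IsProbabilityMeasure μ := ⟨by simp [μ]⟩
  have hind : ∀ i, (fun θ : ℝ => if θ ≤ g i then (1:ℝ) else 0) = (Set.Iic (g i)).indicator 1 := by
    intro i; funext θ; simp [Set.indicator_apply]
  have hint1 : ∀ i, MeasureTheory.Integrable (fun θ : ℝ => if θ ≤ g i then (1:ℝ) else 0) μ := by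
    intro i
    rw [hind]
    exact (MeasureTheory.integrable_const (1:ℝ)).indicator measurableSet_Iic
  have hval : ∀ i, ∫ θ, (if θ ≤ g i then (1:ℝ) else 0) ∂μ = g i := by
    intro i
    rw [hind, MeasureTheory.integral_indicator_one measurableSet_Iic]
    have : Set.Iic (g i) ∩ Set.Ioc 0 1 = Set.Ioc 0 (g i) := by
      ext x; simp only [Set.mem_inter_iff, Set.mem_Iic, Set.mem_Ioc]
      have := hg1 i
      constructor
      · rintro ⟨h1, h2, h3⟩; exact ⟨h2, h1⟩
      · rintro ⟨h1, h2⟩; exact ⟨h2, h1, h2.trans this⟩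
    simp [μ, MeasureTheory.Measure.real, MeasureTheory.Measure.restrict_apply measurableSet_Iic, this, hg0 i]
  have hIntegr : ∀ i ∈ (univ : Finset ι), MeasureTheory.Integrable
      (fun θ : ℝ => a i + β i * (if θ ≤ g i then 1 else 0)) μ := by
    intro i _
    exact (MeasureTheory.integrable_const _).add ((hint1 i).const_mul _)
  have htot : ∫ θ, ∑ i, (a i + β i * (if θ ≤ g i then 1 else 0)) ∂μ = ∑ i, (a i + β i * g i) := by
    rw [MeasureTheory.integral_finsetSum _ hIntegr]
    apply sum_congr rfl
    intro i _
    rw [MeasureTheory.integral_add (MeasureTheory.integrable_const _) ((hint1 i).const_mul _),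
      MeasureTheory.integral_const_mul, hval]
    simp
  obtain ⟨θ, hθ, hle⟩ := MeasureTheory.exists_notMem_null_le_integral (μ := μ)
    (N := (Set.Ioc (0:ℝ) 1)ᶜ)
    (MeasureTheory.integrable_finsetSum _ hIntegr) (by simp [μ])
  simp only [Set.mem_compl_iff, not_not, Set.mem_Ioc] at hθ
  refine ⟨θ, hθ.1, hθ.2, ?_⟩
  rw [htot] at hle
  linarith

lemma count_cover {ι : Type*} [Fintype ι] [DecidableEq ι] (R : ι → ι → Prop) [DecidableRel R]
    (hR : ∀ u v, R u v → R v u) (s t : ℝ) (hs : 0 < s) (ht : 0 < t) (c : ι → ℝ)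
    (hc0 : ∀ i, 0 ≤ c i) (hc : ∀ u v, R u v → s + t ≤ s * c u + t * c v) (x : ℝ)
    (hx : ∑ i, c i ≤ x) :
    ∃ a b : ℝ, 0 ≤ a ∧ 0 ≤ b ∧ (s + t) / s * a + b ≤ x ∧
      (#{e : ι × ι | R e.1 e.2} : ℝ) ≤ b ^ 2 + 2 * a * (Fintype.card ι) - a ^ 2 := by
  classical
  let g : ι → ℝ := fun i => if c i < 1 then c i else max 0 ((s + t - s * c i) / t)
  let p : ℝ := (s + t) / s
  have hp : p = 1 + t / s := by simp only [p]; field_simp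
  obtain ⟨θ, hθ0, hθ1, hθ⟩ := exists_theta g (fun i => if c i < 1 then 0 else p)
    (fun i => if c i < 1 then 1 else 1 - p) x
    (by intro i; simp only [g]; split_ifs
        · exact hc0 i
        · exact le_max_left _ _)
    (by
      intro i; simp only [g]; split_ifs with h
      · exact h.le
      · apply max_le zero_le_one
        rw [div_le_one ht]
        push Not at h
        nlinarith)
    (by
      refine le_trans (sum_le_sum ?_) hx
      intro i _
      simp only [g]; split_ifs with h
      · simp
      · have h1 : (s + t - s * c i) / t ≤ max 0 ((s + t - s * c i) / t) := le_max_right _ _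
        have h2 := mul_le_mul_of_nonneg_left h1 (div_pos ht hs).le
        have h3 : t / s * ((s + t - s * c i) / t) = p - c i := by
          simp only [p]; field_simp
        rw [h3] at h2
        rw [hp] at h2 ⊢
        linarith)
  let A : Finset ι := {i | 1 ≤ c i ∧ g i < θ}
  let B : Finset ι := {i | θ ≤ g i}
  let C : Finset ι := {i | c i < 1 ∧ g i < θ}
  have hAB : Disjoint A B := by
    rw [disjoint_left]; intro i; simp only [A, B, mem_filter_univ]; intro h; push Not; exact h.2
  have hABC : Disjoint (A ∪ B) C := by
    rw [disjoint_left]; intro i; simp only [A, B, C, mem_union, mem_filter_univ]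
    rintro (h | h) h' <;> linarith
  have hun : A ∪ B ∪ C = univ := by
    ext i; simp only [A, B, C, mem_union, mem_filter_univ, mem_univ, iff_true]
    rcases lt_or_ge (g i) θ with h | h
    · rcases lt_or_ge (c i) 1 with h' | h'
      · exact Or.inr ⟨h', h⟩
      · exact Or.inl (Or.inl ⟨h', h⟩)
    · exact Or.inl (Or.inr h)
  have hcard : #A + #B + #C = Fintype.card ι := by
    rw [← card_union_of_disjoint hAB, ← card_union_of_disjoint hABC, hun, card_univ]
  have hsum : p * #A + #B ≤ x := by
    refine le_trans (le_of_eq ?_) hθ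
    have e : ∀ i, ((if c i < 1 then 0 else p) + (if c i < 1 then 1 else 1 - p) * 
        (if θ ≤ g i then 1 else 0)) = p * (if i ∈ A then 1 else 0) + (if i ∈ B then 1 else 0) := by
      intro i
      simp only [A, B, mem_filter_univ]
      by_cases h1 : c i < 1 <;> by_cases h2 : θ ≤ g i <;> simp [h1, h2] 
    rw [sum_congr rfl (fun i _ => e i), sum_add_distrib, ← mul_sum]
    simp
  have key : ∀ u v, R u v → c v < 1 → g v < θ → 1 ≤ c u ∧ g u < θ := by
    intro u v h h1 h2
    have h3 := hc u v h
    have h4 : 1 ≤ c u := by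
      by_contra h5; push Not at h5; nlinarith
    refine ⟨h4, ?_⟩
    simp only [g, h1, if_true, not_lt.2 h4, if_false] at h2 ⊢
    apply max_lt hθ0
    rw [div_lt_iff₀ ht]
    nlinarith
  refine ⟨#A, #B, by positivity, by positivity, hsum, ?_⟩
  have hsub : ({e : ι × ι | R e.1 e.2} : Finset (ι × ι)) ⊆
      (A ∪ B) ×ˢ (A ∪ B) ∪ (A ×ˢ C ∪ C ×ˢ A) := by
    rintro ⟨u, v⟩ h
    simp only [mem_filter_univ] at h
    have hu : u ∈ A ∪ B ∪ C := by rw [hun]; exact mem_univ _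
    have hv : v ∈ A ∪ B ∪ C := by rw [hun]; exact mem_univ _
    rw [mem_union] at hu hv
    have k1 : v ∈ C → u ∈ A := by
      intro hv; simp only [C, A, mem_filter_univ] at hv ⊢; exact key u v h hv.1 hv.2
    have k2 : u ∈ C → v ∈ A := by
      intro hv; simp only [C, A, mem_filter_univ] at hv ⊢; exact key v u (hR _ _ h) hv.1 hv.2
    simp only [mem_union, mem_product] at *
    tauto
  have h1 := card_le_card hsub
  have h2 : #{e : ι × ι | R e.1 e.2} ≤ (#A + #B) * (#A + #B) + (#A * #C + #C * #A) := by
    refine h1.trans ((card_union_le _ _).trans ?_)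
    apply add_le_add
    · rw [card_product, card_union_of_disjoint hAB]
    · refine (card_union_le _ _).trans ?_
      simp [card_product]
  have h3 : (#{e : ι × ι | R e.1 e.2} : ℝ) ≤ (#A + #B) * (#A + #B) + (#A * #C + #C * #A) := by
    exact_mod_cast h2
  have h4 : (Fintype.card ι : ℝ) = #A + #B + #C := by exact_mod_cast hcard.symm
  rw [h4]
  nlinarith

lemma lp_alt {ι E : Type*} [Fintype ι] [DecidableEq ι] [Fintype E] [Nonempty E] (p q : E → ι)
    (s t : ℝ) (hs : 0 < s) (ht : 0 < t) (τ : ℝ) (hτ : 0 < τ) :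
    (∃ x : E → ℝ, (∀ e, 0 ≤ x e) ∧ ∑ e, x e = τ ∧
      ∀ u, ∑ e, x e * ((if p e = u then s else 0) + (if q e = u then t else 0)) ≤ 1) ∨
    ∃ c : ι → ℝ, (∀ i, 0 ≤ c i) ∧ ∑ i, c i = (s + t) * τ ∧
      ∀ e, s + t ≤ s * c (p e) + t * c (q e) := by
  classical
  let vec : E → ι → ℝ := fun e u => (if p e = u then s else 0) + (if q e = u then t else 0)
  let Φ : (E → ℝ) →ₗ[ℝ] (ι → ℝ) := Fintype.linearCombination ℝ vec
  have hΦ : ∀ x u, Φ x u = ∑ e, x e * ((if p e = u then s else 0) + (if q e = u then t else 0)) := by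
    intro x u
    simp [Φ, Fintype.linearCombination_apply, vec, Finset.sum_apply]
  let K : Set (ι → ℝ) := Φ '' stdSimplex ℝ E
  let M : ℝ := 1 / τ
  let L : Set (ι → ℝ) := Set.Iic (fun _ => M)
  by_cases hd : Disjoint L K
  · right
    have hKc : IsCompact K := (isCompact_stdSimplex ℝ E).image (LinearMap.continuous_of_finiteDimensional Φ)
    have hKv : Convex ℝ K := (convex_stdSimplex ℝ E).linear_image Φ
    obtain ⟨f, u, v, hL, huv, hK⟩ := geometric_hahn_banach_closed_compact (convex_Iic _) isClosed_Iic
      hKv hKc hd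
    let fi : ι → ℝ := fun i => f (Pi.single i 1)
    have hf : ∀ y : ι → ℝ, f y = ∑ i, y i * fi i := by
      intro y
      have := LinearMap.pi_apply_eq_sum_univ (f : (ι → ℝ) →ₗ[ℝ] ℝ) y
      simp only [smul_eq_mul] at this
      refine this.trans ?_
      apply sum_congr rfl
      intro i _
      have : (fun j => if i = j then (1:ℝ) else 0) = Pi.single i 1 := by
        funext j
        simp [Pi.single_apply, eq_comm]
      rw [this]
      rfl
    have hM : M * ∑ i, fi i < u := by
      have := hL (fun _ => M) (by simp)
      rw [hf] at this
      rwa [mul_sum]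
    have hfi : ∀ i, 0 ≤ fi i := by
      intro i
      by_contra hneg
      push Not at hneg
      have hN : 0 ≤ (u - M * ∑ i, fi i) / (- fi i) := div_nonneg (by linarith) (by linarith)
      have := hL (fun j => M - (if j = i then (u - M * ∑ i, fi i) / (- fi i) else 0)) (by
        intro j; simp only; split_ifs <;> linarith)
      rw [hf] at this
      simp only [sub_mul, sum_sub_distrib, ← mul_sum, ite_mul, zero_mul, sum_ite_eq', mem_univ, if_true] at this
      have h2 : (u - M * ∑ i, fi i) / (- fi i) * fi i = - (u - M * ∑ i, fi i) := by
        rw [div_neg, neg_mul, div_mul_cancel₀ _ hneg.ne]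
      rw [h2] at this
      linarith
    have hedge : ∀ e, u < s * fi (p e) + t * fi (q e) := by
      intro e
      have := hK (vec e) ⟨Pi.single e 1, single_mem_stdSimplex ℝ e, by
        simp [Φ, Fintype.linearCombination_apply_single]⟩
      rw [hf] at this
      simp only [vec, add_mul, sum_add_distrib, ite_mul, zero_mul, sum_ite_eq, mem_univ, if_true] at this
      linarith
    have hMpos : 0 < M := by positivity
    have hS0 : 0 ≤ ∑ i, fi i := sum_nonneg fun i _ => hfi i
    have hS : 0 < ∑ i, fi i := by
      rcases hS0.lt_or_eq with h | h
      · exact h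
      · exfalso
        have hz : ∀ i, fi i = 0 := by
          intro i
          exact (sum_eq_zero_iff_of_nonneg (fun i _ => hfi i)).1 h.symm i (mem_univ _)
        have := hedge (Classical.arbitrary E)
        rw [← h] at hM
        simp only [hz] at this
        linarith
    refine ⟨fun i => (s + t) / (M * ∑ i, fi i) * fi i, ?_, ?_, ?_⟩
    · intro i
      have := hfi i
      positivity
    · rw [← mul_sum]
      simp only [M]
      field_simp
    · intro e
      have h1 := hedge e
      have h2 : M * ∑ i, fi i ≤ s * fi (p e) + t * fi (q e) := by linarith
      have h3 : 0 < M * ∑ i, fi i := by positivity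
      calc s + t = (s + t) / (M * ∑ i, fi i) * (M * ∑ i, fi i) := by field_simp
        _ ≤ (s + t) / (M * ∑ i, fi i) * (s * fi (p e) + t * fi (q e)) := by gcongr
        _ = _ := by ring
  · left
    rw [Set.not_disjoint_iff] at hd
    obtain ⟨y, hyL, x, hx, rfl⟩ := hd
    refine ⟨fun e => τ * x e, fun e => mul_nonneg hτ.le (hx.1 e), ?_, ?_⟩
    · rw [← mul_sum, hx.2, mul_one]
    · intro u
      have := hyL u
      rw [hΦ] at this
      simp only [M] at this
      rw [le_div_iff₀ hτ] at this
      calc _ = (∑ e, x e * ((if p e = u then s else 0) + (if q e = u then t else 0))) * τ := by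
            rw [sum_mul]; apply sum_congr rfl; intro e _; ring
        _ ≤ 1 := this

lemma greedy {VH V ι J : Type*} [Fintype VH] [DecidableEq V] [DecidableEq ι] [Fintype J]
    (H : SimpleGraph VH) (G : SimpleGraph V) (b : VH → Bool) (part : ι → Finset V)
    (hdisj : ∀ u v, u ≠ v → Disjoint (part u) (part v)) (p q : J → ι) (sz s t : ℕ)
    (hs : s = (Finset.univ.filter fun v => b v = true).card)
    (ht : t = (Finset.univ.filter fun v => b v = false).card)
    (hembed : ∀ j, ∀ A ⊆ part (p j), ∀ B ⊆ part (q j), sz ≤ #A → sz ≤ #B →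
      ∃ f : VH → V, Function.Injective f ∧ (∀ u v, H.Adj u v → G.Adj (f u) (f v)) ∧
        (∀ v, b v = true → f v ∈ A) ∧ (∀ v, b v = false → f v ∈ B))
    (hload : ∀ u, ∑ j, ((if p j = u then s else 0) + (if q j = u then t else 0)) + sz ≤ #(part u)) :
    ∃ f : J → VH → V, (∀ i, Function.Injective (f i)) ∧
      (∀ i u v, H.Adj u v → G.Adj (f i u) (f i v)) ∧
      (∀ i j : J, i ≠ j → ∀ u v, f i u ≠ f j v) := by
  classical
  have main : ∀ S : Finset J, ∃ f : J → VH → V, ∀ i ∈ S, (Function.Injective (f i)) ∧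
      (∀ u v, H.Adj u v → G.Adj (f i u) (f i v)) ∧
      (∀ v, b v = true → f i v ∈ part (p i)) ∧ (∀ v, b v = false → f i v ∈ part (q i)) ∧
      (∀ j ∈ S, i ≠ j → ∀ u v, f i u ≠ f j v) := by
    intro S
    induction S using Finset.induction_on with
    | empty =>
      by_cases hJ : Nonempty (J → VH → V)
      · exact ⟨hJ.some, by simp⟩
      · -- no functions at all: impossible only if J is nonempty
        have hJ' : Nonempty J := by
          by_contra h
          rw [not_nonempty_iff] at h
          exact hJ ⟨fun j => h.elim j⟩
        exfalso
        apply hJ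
        refine ⟨fun j => ?_⟩
        exact (hembed j _ subset_rfl _ subset_rfl
          (by have := hload (p j); omega) (by have := hload (q j); omega)).choose
    | insert j S hj ih =>
      obtain ⟨f, hf⟩ := ih
      let X : Finset V := S.biUnion fun i => univ.image (f i)
      have hX : ∀ u, #(part u ∩ X) + sz ≤ #(part u) := by
        intro u
        refine le_trans ?_ (hload u)
        gcongr
        calc #(part u ∩ X) ≤ ∑ i ∈ S, #(part u ∩ univ.image (f i)) := by
              have : part u ∩ X = S.biUnion fun i => part u ∩ univ.image (f i) := by
                simp only [X, inter_biUnion]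
              rw [this]; exact card_biUnion_le
          _ ≤ ∑ i ∈ S, ((if p i = u then s else 0) + (if q i = u then t else 0)) := by
              apply sum_le_sum
              intro i hi
              obtain ⟨-, -, h1, h2, -⟩ := hf i hi
              have hsub : part u ∩ univ.image (f i) ⊆ 
                  ((if p i = u then univ.filter fun v => b v = true else ∅) ∪ 
                  (if q i = u then univ.filter fun v => b v = false else ∅)).image (f i) := by
                intro x hx
                simp only [mem_inter, mem_image, mem_univ, true_and] at hx
                obtain ⟨hxu, v, rfl⟩ := hx
                refine mem_image_of_mem _ ?_
                rw [mem_union]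
                cases hbv : b v
                · right
                  have : q i = u := by
                    by_contra hne
                    exact disjoint_left.1 (hdisj _ _ hne) (h2 v hbv) hxu
                  simp [this, hbv]
                · left
                  have : p i = u := by
                    by_contra hne
                    exact disjoint_left.1 (hdisj _ _ hne) (h1 v hbv) hxu
                  simp [this, hbv]
              refine (card_le_card hsub).trans (card_image_le.trans ((card_union_le _ _).trans ?_))
              apply add_le_add
              · split_ifs <;> simp [hs]
              · split_ifs <;> simp [ht]
          _ ≤ _ := sum_le_sum_of_subset (subset_univ _)
      have hsd : ∀ u, sz ≤ #(part u \ X) := by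
        intro u
        have := card_sdiff_add_card_inter (part u) X
        have := hX u
        omega
      obtain ⟨φ, hφ1, hφ2, hφ3, hφ4⟩ := hembed j (part (p j) \ X) sdiff_subset (part (q j) \ X)
        sdiff_subset (hsd _) (hsd _)
      have hφX : ∀ v, φ v ∉ X := by
        intro v
        cases hbv : b v
        · exact (mem_sdiff.1 (hφ4 v hbv)).2
        · exact (mem_sdiff.1 (hφ3 v hbv)).2
      have hXmem : ∀ i ∈ S, ∀ v, f i v ∈ X := by
        intro i hi v
        exact mem_biUnion.2 ⟨i, hi, mem_image_of_mem _ (mem_univ _)⟩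
      refine ⟨Function.update f j φ, ?_⟩
      have hne : ∀ i ∈ S, i ≠ j := fun i hi h => hj (h ▸ hi)
      intro i hi
      rcases mem_insert.1 hi with rfl | hi'
      · simp only [Function.update_self]
        refine ⟨hφ1, hφ2, fun v hv => (mem_sdiff.1 (hφ3 v hv)).1,
          fun v hv => (mem_sdiff.1 (hφ4 v hv)).1, ?_⟩
        intro k hk hik u v
        rcases mem_insert.1 hk with rfl | hk
        · exact absurd rfl hik
        · rw [Function.update_of_ne (hne k hk)]
          intro h
          exact hφX u (h ▸ hXmem k hk v)
      · rw [Function.update_of_ne (hne i hi')]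
        obtain ⟨a1, a2, a3, a4, a5⟩ := hf i hi'
        refine ⟨a1, a2, a3, a4, ?_⟩
        intro k hk hik u v
        rcases mem_insert.1 hk with rfl | hk
        · rw [Function.update_self]
          intro h
          exact hφX v (h ▸ hXmem i hi' u)
        · rw [Function.update_of_ne (hne k hk)]
          exact a5 k hk hik u v
  obtain ⟨f, hf⟩ := main univ
  exact ⟨f, fun i => (hf i (mem_univ _)).1, fun i => (hf i (mem_univ _)).2.1,
    fun i j hij => (hf i (mem_univ _)).2.2.2.2 j (mem_univ _) hij⟩

-- embedding from kst output
lemma embed_of_kst {VH V : Type*} [Fintype VH] [DecidableEq V]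
    (H : SimpleGraph VH) (G : SimpleGraph V) (b : VH → Bool) (hb : ∀ u v, H.Adj u v → b u ≠ b v)
    (s t : ℕ)
    (hs : s = (Finset.univ.filter fun v => b v = true).card)
    (ht : t = (Finset.univ.filter fun v => b v = false).card)
    (A B : Finset V) (hAB : Disjoint A B) (g : Fin s → V) (h : Fin t → V)
    (hg : Function.Injective g) (hh : Function.Injective h) (hgA : ∀ i, g i ∈ A) (hhB : ∀ j, h j ∈ B)
    (hgh : ∀ i j, G.Adj (g i) (h j)) :
    ∃ f : VH → V, Function.Injective f ∧ (∀ u v, H.Adj u v → G.Adj (f u) (f v)) ∧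
        (∀ v, b v = true → f v ∈ A) ∧ (∀ v, b v = false → f v ∈ B) := by
  classical
  let e1 : {v : VH // b v = true} ≃ Fin s := Fintype.equivFinOfCardEq (by
    rw [hs, Fintype.card_subtype])
  let e2 : {v : VH // b v = false} ≃ Fin t := Fintype.equivFinOfCardEq (by
    rw [ht, Fintype.card_subtype])
  let f : VH → V := fun v => if hv : b v = true then g (e1 ⟨v, hv⟩)
    else h (e2 ⟨v, by simpa using hv⟩)
  have f1 : ∀ v (hv : b v = true), f v = g (e1 ⟨v, hv⟩) := fun v hv => dif_pos hv
  have f2 : ∀ v (hv : b v = false), f v = h (e2 ⟨v, hv⟩) := fun v hv => dif_neg (by simp [hv])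
  refine ⟨f, ?_, ?_, fun v hv => f1 v hv ▸ hgA _, fun v hv => f2 v hv ▸ hhB _⟩
  · intro u v huv
    cases hu : b u <;> cases hv : b v
    · rw [f2 u hu, f2 v hv] at huv
      simpa using e2.injective (hh huv)
    · rw [f2 u hu, f1 v hv] at huv
      exact absurd (hhB (e2 ⟨u, hu⟩)) (huv ▸ disjoint_left.1 hAB (hgA _))
    · rw [f1 u hu, f2 v hv] at huv
      exact absurd (hhB (e2 ⟨v, hv⟩)) (huv ▸ disjoint_left.1 hAB (hgA _))
    · rw [f1 u hu, f1 v hv] at huv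
      simpa using e1.injective (hg huv)
  · intro u v huv
    have := hb u v huv
    cases hu : b u <;> cases hv : b v
    · simp [hu, hv] at this
    · rw [f2 u hu, f1 v hv]; exact (hgh _ _).symm
    · rw [f1 u hu, f2 v hv]; exact hgh _ _
    · simp [hu, hv] at this

end Tiling

namespace Tiling
open Finset

lemma numeric (a b p X k : ℝ) (ha : 0 ≤ a) (hb : 0 ≤ b) (hp : 1 ≤ p) 
    (h : p * a + b ≤ X) :
    b ^ 2 + 2 * a * k - a ^ 2 ≤ max (X ^ 2) (2 * (X / p) * k - (X / p) ^ 2) := by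
  have hp0 : 0 < p := by linarith
  obtain ⟨Y, rfl⟩ : ∃ Y, X = p * Y := ⟨X / p, by field_simp⟩
  rw [mul_div_cancel_left₀ _ hp0.ne']
  have haY : a ≤ Y := by
    have : p * a ≤ p * Y := by linarith
    exact le_of_mul_le_mul_left this hp0
  have hb2 : b ^ 2 ≤ (p * (Y - a)) ^ 2 := by
    apply pow_le_pow_left₀ hb; linarith
  set Z := max ((p * Y) ^ 2) (2 * Y * k - Y ^ 2)
  have h1 : (p * Y) ^ 2 ≤ Z := le_max_left _ _
  have h2 : 2 * Y * k - Y ^ 2 ≤ Z := le_max_right _ _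
  rcases (ha.trans haY).eq_or_lt with h0 | h0
  · have : a = 0 := by linarith
    subst this; subst h0
    nlinarith
  · have h3 : ((p * (Y - a)) ^ 2 + 2 * a * k - a ^ 2) * Y ≤ Z * Y := by
      have e1 := mul_le_mul_of_nonneg_left h1 (sub_nonneg.2 haY)
      have e2 := mul_le_mul_of_nonneg_left h2 ha
      have e3 : 0 ≤ (p ^ 2 - 1) * (a * (Y - a) * Y) :=
        mul_nonneg (by nlinarith) (mul_nonneg (mul_nonneg ha (by linarith)) h0.le)
      nlinarith
    have := le_of_mul_le_mul_right h3 h0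
    linarith

lemma frac_tiling {ι : Type*} [Fintype ι] [DecidableEq ι] (R : ι → ι → Prop) [DecidableRel R]
    (hR : ∀ u v, R u v → R v u) (s t : ℕ) (hs : 0 < s) (ht : 0 < t) (α : ℝ) (hα : 0 < α)
    (hcard : 0 < Fintype.card ι)
    (hr : Tst s t α * (Fintype.card ι : ℝ) ^ 2 < (#{e : ι × ι | R e.1 e.2} : ℝ)) :
    ∃ x : {e : ι × ι // R e.1 e.2} → ℝ, (∀ e, 0 ≤ x e) ∧
      ∑ e, x e = α * Fintype.card ι / (s + t) ∧
      ∀ u, ∑ e, x e * ((if e.1.1 = u then (s:ℝ) else 0) + (if e.1.2 = u then (t:ℝ) else 0)) ≤ 1 := by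
  have hT0 : 0 ≤ Tst s t α := le_trans (sq_nonneg α) (le_max_right _ _)
  have hs' : (0:ℝ) < s := by exact_mod_cast hs
  have ht' : (0:ℝ) < t := by exact_mod_cast ht
  have hk' : (0:ℝ) < Fintype.card ι := by exact_mod_cast hcard
  have hne : Nonempty {e : ι × ι // R e.1 e.2} := by
    by_contra h
    rw [not_nonempty_iff] at h
    have : #{e : ι × ι | R e.1 e.2} = 0 := by
      rw [← Fintype.card_subtype, Fintype.card_eq_zero]
    rw [this] at hr
    have : 0 ≤ Tst s t α * (Fintype.card ι : ℝ) ^ 2 := by positivity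
    push_cast at hr
    linarith
  rcases lp_alt (fun e : {e : ι × ι // R e.1 e.2} => e.1.1) (fun e => e.1.2) (s:ℝ) t hs' ht'
    (α * Fintype.card ι / (s + t)) (by positivity) with h | ⟨c, hc0, hcs, hce⟩
  · exact h
  · exfalso
    obtain ⟨a, b, ha, hb, hab, hle⟩ := count_cover R hR (s:ℝ) t hs' ht' c hc0 
      (fun u v h => hce ⟨(u, v), h⟩) (α * Fintype.card ι) (by
        rw [hcs]; apply le_of_eq; field_simp)
    have := numeric a b ((s + t) / s) _ (Fintype.card ι) ha hb
      (by rw [le_div_iff₀ hs']; linarith) hab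
    have h2 : Tst s t α * (Fintype.card ι : ℝ) ^ 2 = 
        max ((α * Fintype.card ι) ^ 2) (2 * (α * Fintype.card ι / ((s + t) / s)) * Fintype.card ι
          - (α * Fintype.card ι / ((s + t) / s)) ^ 2) := by
      unfold Tst
      rw [max_comm, max_mul_of_nonneg _ _ (by positivity)]
      congr 1
      · ring
      · field_simp
    linarith

lemma Tst_lt (s t : ℕ) (hs : 0 < s) (ht : 0 < t) (α α' : ℝ) (h0 : 0 < α') (h1 : α' < α) (h2 : α < 1) :
    Tst s t α' < Tst s t α := by
  have hs' : (0:ℝ) < s := by exact_mod_cast hs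
  have ht' : (0:ℝ) < t := by exact_mod_cast ht
  have e : ∀ α : ℝ, (2 * s * α / (s + t)) * (1 - s * α / (2 * (s + t))) =
    2 * (s / (s + t) * α) - (s / (s + t) * α) ^ 2 := by intro α; field_simp
  unfold Tst
  rw [e, e]
  have q0 : (0:ℝ) < s / (s + t) := by positivity
  have q1 : (s:ℝ) / (s + t) < 1 := by rw [div_lt_one (by positivity)]; linarith
  set q := (s:ℝ) / (s + t)
  apply max_lt_max
  · have : q * α' < q * α := by gcongr
    have : q * α < 1 := by nlinarith
    nlinarith
  · gcongr

lemma Tst_le_one (s t : ℕ) (hs : 0 < s) (ht : 0 < t) (α : ℝ) (h0 : 0 < α) (h2 : α < 1) :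
    Tst s t α ≤ 1 := by
  have hs' : (0:ℝ) < s := by exact_mod_cast hs
  have ht' : (0:ℝ) < t := by exact_mod_cast ht
  have e : ∀ α : ℝ, (2 * s * α / (s + t)) * (1 - s * α / (2 * (s + t))) =
    2 * (s / (s + t) * α) - (s / (s + t) * α) ^ 2 := by intro α; field_simp
  unfold Tst
  rw [e]
  apply max_le
  · nlinarith [sq_nonneg (1 - s / (s + t) * α)]
  · nlinarith

lemma reduced_count {V : Type} [Fintype V] [DecidableEq V] [Nonempty V] (G : SimpleGraph V)
    [DecidableRel G.Adj] (P : Finpartition (univ : Finset V)) (δ : ℝ) (hδ : 0 < δ)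
    (hP : P.IsEquipartition) (hPε : P.IsUniform G (δ / 8)) (hP' : 4 / δ ≤ #P.parts)
    (R : P.parts → P.parts → Prop) [DecidableRel R]
    (hR : ∀ u v, R u v ↔ u ≠ v ∧ G.IsUniform (δ / 8) u.1 v.1 ∧ δ / 4 ≤ G.edgeDensity u.1 v.1) :
    2 * (#G.edgeFinset : ℝ) ≤ 2 * δ * (Fintype.card V : ℝ) ^ 2 +
      #{e : P.parts × P.parts | R e.1 e.2} * ((Fintype.card V / #P.parts : ℕ) + 1 : ℝ) ^ 2 := by
  classical
  have h := SimpleGraph.regularityReduced_edges_card_aux hδ hP hPε hP'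
  have h2 : 2 * #(G.regularityReduced P (δ / 8) (δ / 4)).edgeFinset ≤
      #{e : P.parts × P.parts | R e.1 e.2} * ((Fintype.card V / #P.parts) + 1) ^ 2 := by
    rw [SimpleGraph.two_mul_card_edgeFinset]
    calc _ ≤ #(({e : P.parts × P.parts | R e.1 e.2} : Finset _).biUnion
            fun e => e.1.1 ×ˢ e.2.1) := by
          apply card_le_card
          rintro ⟨x, y⟩ hxy
          simp only [mem_filter_univ, SimpleGraph.regularityReduced_adj] at hxy
          obtain ⟨-, U, hU, W, hW, hx, hy, hne, hun, hde⟩ := hxy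
          simp only [mem_biUnion, mem_filter_univ, mem_product]
          refine ⟨(⟨U, hU⟩, ⟨W, hW⟩), (hR _ _).2 ⟨?_, hun, hde⟩, hx, hy⟩
          intro h
          exact hne (congrArg Subtype.val h)
      _ ≤ _ := by
          apply card_biUnion_le_card_mul
          intro e _
          rw [card_product, sq]
          have := hP.card_part_le_average_add_one e.1.2
          have := hP.card_part_le_average_add_one e.2.2
          rw [card_univ] at *
          gcongr
  have h3 : 2 * (#(G.regularityReduced P (δ / 8) (δ / 4)).edgeFinset : ℝ) ≤
      #{e : P.parts × P.parts | R e.1 e.2} * ((Fintype.card V / #P.parts : ℕ) + 1 : ℝ) ^ 2 := by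
    exact_mod_cast h2
  push_cast at h
  linarith

end Tiling

namespace Tiling
open Finset

/-- From a fractional tiling of the reduced structure to an actual tiling. -/
lemma tiling_of_frac {VH V ι E : Type*} [Fintype VH] [DecidableEq V] [DecidableEq ι] [Fintype E]
    (H : SimpleGraph VH) (G : SimpleGraph V) (b : VH → Bool) (part : ι → Finset V)
    (hdisj : ∀ u v, u ≠ v → Disjoint (part u) (part v)) (p q : E → ι) (s t m : ℕ) (β : ℝ)
    (hβ0 : 0 ≤ β) (hβ1 : β ≤ 1)
    (hs : s = (Finset.univ.filter fun v => b v = true).card)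
    (ht : t = (Finset.univ.filter fun v => b v = false).card)
    (hembed : ∀ j, ∀ A ⊆ part (p j), ∀ B ⊆ part (q j), ⌊β * m⌋₊ ≤ #A → ⌊β * m⌋₊ ≤ #B →
      ∃ f : VH → V, Function.Injective f ∧ (∀ u v, H.Adj u v → G.Adj (f u) (f v)) ∧
        (∀ v, b v = true → f v ∈ A) ∧ (∀ v, b v = false → f v ∈ B))
    (hm : ∀ u, m ≤ #(part u)) (x : E → ℝ) (hx0 : ∀ e, 0 ≤ x e)
    (hx : ∀ u, ∑ e, x e * ((if p e = u then (s:ℝ) else 0) + (if q e = u then (t:ℝ) else 0)) ≤ 1) :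
    ∃ k : ℕ, (1 - β) * m * ∑ e, x e - Fintype.card E ≤ k ∧ HasTiling H G k := by
  classical
  let N : E → ℕ := fun e => ⌊x e * ((1 - β) * m)⌋₊
  have h1β : 0 ≤ (1 - β) * m := mul_nonneg (by linarith) (by positivity)
  have hNle : ∀ e, (N e : ℝ) ≤ x e * ((1 - β) * m) := fun e =>
    Nat.floor_le (mul_nonneg (hx0 e) h1β)
  have hNge : ∀ e, x e * ((1 - β) * m) - 1 ≤ (N e : ℝ) := fun e => (Nat.sub_one_lt_floor _).le
  let J := Σ e : E, Fin (N e)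
  have hJ : Fintype.card J = ∑ e, N e := by simp [J]
  obtain ⟨f, hf1, hf2, hf3⟩ := greedy (J := J) H G b part hdisj (fun j => p j.1) (fun j => q j.1)
    ⌊β * m⌋₊ s t hs ht (fun j => hembed j.1) (by
      intro u
      refine le_trans ?_ (hm u)
      have e1 : ∑ j : J, ((if p j.1 = u then s else 0) + (if q j.1 = u then t else 0)) =
          ∑ e, N e * ((if p e = u then s else 0) + (if q e = u then t else 0)) := by
        rw [Fintype.sum_sigma]
        apply sum_congr rfl
        intro e _
        change ∑ _y : Fin (N e), ((if p e = u then s else 0) + if q e = u then t else 0) = _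
        rw [sum_const, card_univ, Fintype.card_fin, smul_eq_mul]
      rw [e1]
      have e2 : ((∑ e, N e * ((if p e = u then s else 0) + (if q e = u then t else 0)) : ℕ) : ℝ)
          ≤ (1 - β) * m := by
        push_cast
        calc _ ≤ ∑ e, (x e * ((1 - β) * m)) * ((if p e = u then (s:ℝ) else 0) + (if q e = u then (t:ℝ) else 0)) := by
              apply sum_le_sum
              intro e _
              apply mul_le_mul_of_nonneg_right (hNle e)
              positivity
          _ = ((1 - β) * m) * ∑ e, x e * ((if p e = u then (s:ℝ) else 0) + (if q e = u then (t:ℝ) else 0)) := by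
              rw [mul_sum]; apply sum_congr rfl; intro e _; ring
          _ ≤ ((1 - β) * m) * 1 := mul_le_mul_of_nonneg_left (hx u) h1β
          _ = _ := mul_one _
      have e3 : ((⌊β * m⌋₊ : ℕ) : ℝ) ≤ β * m := Nat.floor_le (by positivity)
      have : (((∑ e, N e * ((if p e = u then s else 0) + (if q e = u then t else 0)) : ℕ)
        + ⌊β * m⌋₊ : ℕ) : ℝ) ≤ m := by
        rw [Nat.cast_add]
        linarith
      exact_mod_cast this)
  refine ⟨Fintype.card J, ?_, ?_⟩
  · rw [hJ]
    push_cast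
    have : ∑ e, (x e * ((1 - β) * m) - 1) ≤ ∑ e, (N e : ℝ) := sum_le_sum fun e _ => hNge e
    rw [sum_sub_distrib, ← sum_mul] at this
    simp only [sum_const, card_univ, nsmul_eq_mul, mul_one] at this
    linarith
  · let eq := (Fintype.equivFin J).symm
    exact ⟨fun i => f (eq i), fun i => hf1 _, fun i => hf2 _,
      fun i j hij => hf3 _ _ (fun h => hij (eq.injective h))⟩

lemma sq_add_le (n k : ℝ) (hk : 0 ≤ k) (hkn : k ≤ n) : (n + k) ^ 2 ≤ n ^ 2 + 3 * k * n := by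
  nlinarith [mul_le_mul_of_nonneg_left hkn hk]

set_option maxHeartbeats 2000000 in
lemma main_pos {VH : Type*} [Fintype VH] (H : SimpleGraph VH)
    (b : VH → Bool) (hb : ∀ u v, H.Adj u v → b u ≠ b v)
    (s t : ℕ)
    (hs : s = (Finset.univ.filter fun v => b v = true).card)
    (ht : t = (Finset.univ.filter fun v => b v = false).card)
    (hs0 : 0 < s) (ht0 : 0 < t)
    (α : ℝ) (hα0 : 0 < α) (hα1 : α < 1) (ε : ℝ) (hε : 0 < ε) (hε1 : ε ≤ 1 / 2) :
    ∃ n₀ : ℕ, ∀ n : ℕ, n₀ ≤ n → ∀ G : SimpleGraph (Fin n),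
      Tst s t α * (n.choose 2 : ℝ) ≤ (G.edgeSet.ncard : ℝ) →
      ∃ k : ℕ, (1 - ε) * (α / ((s : ℝ) + (t : ℝ))) * (n : ℝ) < (k : ℝ) ∧
        HasTiling H G k := by
  classical
  have hs' : (1:ℝ) ≤ s := by exact_mod_cast hs0
  have ht' : (1:ℝ) ≤ t := by exact_mod_cast ht0
  obtain ⟨β, hβ⟩ : ∃ β, β = ε / 4 := ⟨_, rfl⟩
  have hβ0 : 0 < β := by linarith
  have hβ1 : β ≤ 1 / 8 := by linarith
  obtain ⟨α', hα'⟩ : ∃ α', α' = (1 - β) * α := ⟨_, rfl⟩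
  have hα'0 : 0 < α' := by rw [hα']; exact mul_pos (by linarith) hα0
  have hα'1 : α' < α := by rw [hα']; nlinarith
  have hT := Tst_lt s t hs0 ht0 α α' hα'0 hα'1 hα1
  have hT1 := Tst_le_one s t hs0 ht0 α hα0 hα1
  have hT'0 : 0 ≤ Tst s t α' := le_trans (sq_nonneg α') (le_max_right _ _)
  set T := Tst s t α with hTdef
  set T' := Tst s t α' with hT'def
  obtain ⟨δ, hδ⟩ : ∃ δ, δ = min ((T - T') / 4) β := ⟨_, rfl⟩
  have hδ0 : 0 < δ := by rw [hδ]; exact lt_min (by linarith) hβ0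
  have hδ1 : δ ≤ (T - T') / 4 := hδ ▸ min_le_left _ _
  have hδ2 : δ ≤ β := hδ ▸ min_le_right _ _
  obtain ⟨N, hN⟩ := kst s t hs0 (δ / 8) (by positivity)
  obtain ⟨l, hl⟩ : ∃ l : ℕ, l = ⌈4 / δ⌉₊ + 1 := ⟨_, rfl⟩
  obtain ⟨Bd, hBd⟩ : ∃ Bd : ℕ, Bd = SzemerediRegularity.bound (δ / 8) l := ⟨_, rfl⟩
  obtain ⟨M0, hM0⟩ : ∃ M0 : ℕ, M0 = ⌈((N:ℝ) + 4) / β⌉₊ := ⟨_, rfl⟩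
  obtain ⟨n1, hn1⟩ := exists_nat_gt ((3 * (Bd:ℝ) + 1) / ((T - T') / 2))
  obtain ⟨n2, hn2⟩ := exists_nat_gt (((Bd:ℝ) + Bd ^ 2) / (ε / 2 * (α / (s + t))))
  refine ⟨l + Bd + M0 * Bd + n1 + n2 + 1, ?_⟩
  intro n hn G hG
  have hnpos : 0 < n := by omega
  have : Nonempty (Fin n) := ⟨⟨0, hnpos⟩⟩
  obtain ⟨P, hP1, hP2, hP3, hP4⟩ := szemeredi_regularity G (ε := δ / 8) (l := l) (by positivity)
    (by rw [Fintype.card_fin]; nlinarith [Nat.zero_le (M0 * Bd)])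
  rw [← hBd] at hP3
  let ι := {x // x ∈ P.parts}
  let R : ι → ι → Prop := fun u v =>
    u ≠ v ∧ G.IsUniform (δ / 8) u.1 v.1 ∧ δ / 4 ≤ G.edgeDensity u.1 v.1
  have hRsymm : ∀ u v, R u v → R v u := by
    rintro u v ⟨h1, h2, h3⟩
    exact ⟨h1.symm, h2.symm, by rw [SimpleGraph.edgeDensity_comm]; exact h3⟩
  have hk : Fintype.card ι = #P.parts := by simp [ι]
  set k := #P.parts with hkdef
  set m := n / k with hm
  have hkpos : 0 < k := by omega
  have hkR : (0:ℝ) < k := by exact_mod_cast hkpos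
  have hkB : (k:ℝ) ≤ Bd := by exact_mod_cast hP3
  have hl4 : 4 / δ ≤ (k:ℝ) := by
    have h1 := Nat.le_ceil (4 / δ)
    have h2 : ((⌈4 / δ⌉₊ : ℕ) : ℝ) ≤ k := by exact_mod_cast (by omega : ⌈4 / δ⌉₊ ≤ k)
    linarith
  have hnR : (0:ℝ) < n := by exact_mod_cast hnpos
  have hnk : (k:ℝ) ≤ n := by
    have : k ≤ n := by have := Nat.zero_le (M0 * Bd); omega
    exact_mod_cast this
  have hmk : (m:ℝ) * k ≤ n := by exact_mod_cast Nat.div_mul_le_self n k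
  have hmk2 : (n:ℝ) - k ≤ m * k := by
    have h1 := Nat.div_add_mod n k
    have h2 := Nat.mod_lt n hkpos
    have h3 : n ≤ m * k + k := by rw [hm, mul_comm]; omega
    have : (n:ℝ) ≤ m * k + k := by exact_mod_cast h3
    linarith
  have hmM : M0 ≤ m := by
    rw [hm, Nat.le_div_iff_mul_le hkpos]
    have : M0 * k ≤ M0 * Bd := Nat.mul_le_mul_left _ hP3
    omega
  have hmβ : (N:ℝ) + 4 ≤ β * m := by
    have h1 := Nat.le_ceil (((N:ℝ) + 4) / β)
    rw [← hM0] at h1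
    have h2 : (M0:ℝ) ≤ m := by exact_mod_cast hmM
    have h3 := h1.trans h2
    rw [div_le_iff₀ hβ0] at h3
    linarith
  -- edge count
  have hcount := reduced_count G P δ hδ0 hP1 hP4 hl4 R (fun u v => Iff.rfl)
  rw [Fintype.card_fin] at hcount
  have hedge : (G.edgeSet.ncard : ℝ) = #G.edgeFinset := by
    rw [Set.ncard_eq_toFinset_card']; rfl
  have hchoose : (n.choose 2 : ℝ) = n * (n - 1) / 2 := Nat.cast_choose_two ℝ n
  have hr : T' * (Fintype.card ι : ℝ) ^ 2 < (#{e : ι × ι | R e.1 e.2} : ℝ) := by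
    rw [hk]
    by_contra hcon
    push Not at hcon
    rw [hedge, hchoose] at hG
    have h1 : (#{e : ι × ι | R e.1 e.2} : ℝ) * ((m:ℝ) + 1) ^ 2 ≤ T' * ((n:ℝ) + k) ^ 2 := by
      calc _ ≤ T' * (k:ℝ) ^ 2 * ((m:ℝ) + 1) ^ 2 := by gcongr
        _ = T' * (m * k + k) ^ 2 := by ring
        _ ≤ _ := by gcongr
    have h2 : T * (n * (n - 1)) ≤ 2 * δ * n ^ 2 + T' * ((n:ℝ) + k) ^ 2 := by
      have : 2 * (#G.edgeFinset : ℝ) ≤ 2 * δ * n ^ 2 + T' * ((n:ℝ) + k) ^ 2 := by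
        refine hcount.trans ?_
        gcongr
      linarith
    have h3 : T' * ((n:ℝ) + k) ^ 2 ≤ T' * n ^ 2 + 3 * k * n := by
      have : ((n:ℝ) + k) ^ 2 ≤ n ^ 2 + 3 * k * n := sq_add_le _ _ hkR.le hnk
      have h5 : T' ≤ 1 := by linarith
      have : T' * ((n:ℝ) + k) ^ 2 ≤ T' * (n ^ 2 + 3 * k * n) := by gcongr
      have h6 : T' * (3 * k * n) ≤ 1 * (3 * k * n) := by gcongr
      linarith
    have h4 : (T - T') / 2 * n * n ≤ (3 * k + 1) * n := by
      have h5 : T * n ≤ 1 * n := by gcongr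
      have h6 : 2 * δ * (n:ℝ) ^ 2 ≤ 2 * ((T - T') / 4) * n ^ 2 := by gcongr
      linarith
    have h5 := le_of_mul_le_mul_right h4 hnR
    rw [div_lt_iff₀ (by linarith)] at hn1
    have h6 : (n1:ℝ) ≤ n := by
      exact_mod_cast (by have := Nat.zero_le (M0 * Bd); omega : n1 ≤ n)
    have h7 : (n1:ℝ) * ((T - T') / 2) ≤ n * ((T - T') / 2) := by
      apply mul_le_mul_of_nonneg_right h6; linarith
    linarith
  obtain ⟨x, hx0, hxs, hxl⟩ := frac_tiling R hRsymm s t hs0 ht0 α' hα'0 (by omega) hr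
  obtain ⟨K, hK, htil⟩ := tiling_of_frac H G b (fun u : ι => u.1)
    (by
      intro u v huv
      exact P.disjoint u.2 v.2 (fun h => huv (Subtype.ext h)))
    (fun e : {e : ι × ι // R e.1 e.2} => e.1.1) (fun e => e.1.2) s t m β hβ0.le (by linarith) hs ht
    (by
      rintro ⟨⟨U, W⟩, hUW⟩ A hA B hB hAc hBc
      obtain ⟨hne, hun, hde⟩ := hUW
      simp only at hA hB hne hun hde
      have hUWd : Disjoint U.1 W.1 := P.disjoint U.2 W.2 (fun h => hne (Subtype.ext h))
      have hfl : β * m - 1 ≤ (⌊β * m⌋₊ : ℝ) := (Nat.sub_one_lt_floor _).le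
      have hAR : β * m - 1 ≤ #A := hfl.trans (by exact_mod_cast hAc)
      have hBR : β * m - 1 ≤ #B := hfl.trans (by exact_mod_cast hBc)
      have hsz : ∀ U : ι, (#U.1 : ℝ) * (δ / 8) ≤ β * m - 1 := by
        intro U
        have h1 := hP1.card_part_le_average_add_one U.2
        rw [card_univ, Fintype.card_fin] at h1
        have h2 : (#U.1 : ℝ) ≤ m + 1 := by exact_mod_cast h1
        have h3 : (0:ℝ) ≤ N := by positivity
        calc (#U.1 : ℝ) * (δ / 8) ≤ (m + 1) * (β / 8) := by gcongr
          _ ≤ _ := by linarith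
      have hdens := hun hA hB ((hsz U).trans hAR) ((hsz W).trans hBR)
      have hd2 : δ / 8 ≤ (G.edgeDensity A B : ℝ) := by
        rw [abs_lt] at hdens
        linarith [hdens.1]
      obtain ⟨g, h, hg, hh, hgA, hhB, hgh⟩ := hN (Fin n) G A B
        (by
          have : (N:ℝ) ≤ #A := by linarith
          exact_mod_cast this)
        (by
          have : (N:ℝ) ≤ #B := by linarith
          exact_mod_cast this) hd2
      exact embed_of_kst H G b hb s t hs ht A B (hUWd.mono hA hB) g h hg hh hgA hhB hgh)
    (by
      intro u
      have := hP1.average_le_card_part u.2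
      rw [card_univ, Fintype.card_fin] at this
      exact this)
    x hx0 hxl
  refine ⟨K, lt_of_lt_of_le ?_ hK, htil⟩
  rw [hxs, hk]
  have hE : (Fintype.card {e : ι × ι // R e.1 e.2} : ℝ) ≤ (k:ℝ) ^ 2 := by
    have h1 : Fintype.card {e : ι × ι // R e.1 e.2} ≤ Fintype.card (ι × ι) :=
      Fintype.card_subtype_le _
    rw [Fintype.card_prod, hk, ← sq] at h1
    exact_mod_cast h1
  set γ := α / ((s:ℝ) + t) with hγ
  have hγ0 : 0 < γ := by positivity
  have hγ1 : γ ≤ 1 := by rw [hγ, div_le_one (by positivity)]; linarith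
  have e1 : (1 - β) * m * (α' * k / (s + t)) = (1 - β) ^ 2 * γ * (m * k) := by
    rw [hα', hγ]; ring
  rw [e1]
  have hb2 : 1 - ε / 2 ≤ (1 - β) ^ 2 := by rw [hβ]; nlinarith [sq_nonneg ε]
  have hb3 : (1 - β) ^ 2 ≤ 1 := by nlinarith
  have e2 : (1 - β) ^ 2 * γ * (n - k) ≤ (1 - β) ^ 2 * γ * (m * k) := by gcongr
  have e3 : (1 - ε / 2) * γ * n ≤ (1 - β) ^ 2 * γ * n := by gcongr
  have e4 : (1 - β) ^ 2 * γ * k ≤ 1 * 1 * k := by gcongr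
  rw [div_lt_iff₀ (by positivity)] at hn2
  have h6 : (n2:ℝ) ≤ n := by
    exact_mod_cast (by have := Nat.zero_le (M0 * Bd); omega : n2 ≤ n)
  have e5 : (n2:ℝ) * (ε / 2 * γ) ≤ n * (ε / 2 * γ) := by gcongr
  have e6 : (k:ℝ) ^ 2 ≤ (Bd:ℝ) ^ 2 := by gcongr
  linarith

end Tiling

theorem main_result {VH : Type*} [Fintype VH] (H : SimpleGraph VH)
    (hiso : ∀ v : VH, ∃ u, H.Adj v u)
    (b : VH → Bool) (hb : ∀ u v, H.Adj u v → b u ≠ b v)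
    (hmin : ∀ c : VH → Bool, (∀ u v, H.Adj u v → c u ≠ c v) →
      (Finset.univ.filter fun v => b v = true).card ≤
        (Finset.univ.filter fun v => c v = true).card)
    (s t : ℕ)
    (hs : s = (Finset.univ.filter fun v => b v = true).card)
    (ht : t = (Finset.univ.filter fun v => b v = false).card)
    (α : ℝ) (hα : α ∈ Set.Ioo (0 : ℝ) 1) (ε : ℝ) (hε : 0 < ε) :
    ∃ n₀ : ℕ, ∀ n : ℕ, n₀ ≤ n → ∀ G : SimpleGraph (Fin n),
      Tst s t α * (n.choose 2 : ℝ) ≤ (G.edgeSet.ncard : ℝ) →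
      ∃ k : ℕ, (1 - ε) * (α / ((s : ℝ) + (t : ℝ))) * (n : ℝ) < (k : ℝ) ∧
        HasTiling H G k := by
  rcases isEmpty_or_nonempty VH with hE | ⟨⟨v⟩⟩
  · refine ⟨0, fun n _ G _ => ⟨1, ?_, fun _ v => hE.elim v, fun i u => hE.elim u,
      fun i u => hE.elim u, fun i j _ u => hE.elim u⟩⟩
    have h1 : s = 0 := by rw [hs]; simp
    have h2 : t = 0 := by rw [ht]; simp
    subst h1; subst h2
    simp
  · obtain ⟨u, hu⟩ := hiso v
    have hne := hb v u hu
    have hboth : (∃ x, b x = true) ∧ (∃ x, b x = false) := by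
      cases h1 : b v <;> cases h2 : b u
      · simp [h1, h2] at hne
      · exact ⟨⟨u, h2⟩, ⟨v, h1⟩⟩
      · exact ⟨⟨v, h1⟩, ⟨u, h2⟩⟩
      · simp [h1, h2] at hne
    obtain ⟨⟨x, hx⟩, ⟨y, hy⟩⟩ := hboth
    have hs0 : 0 < s := by
      rw [hs]; exact Finset.card_pos.2 ⟨x, by simp [hx]⟩
    have ht0 : 0 < t := by
      rw [ht]; exact Finset.card_pos.2 ⟨y, by simp [hy]⟩
    obtain ⟨n₀, hn₀⟩ := Tiling.main_pos H b hb s t hs ht hs0 ht0 α hα.1 hα.2 (min ε (1 / 2))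
      (lt_min hε (by norm_num)) (min_le_right _ _)
    refine ⟨n₀, fun n hn G hG => ?_⟩
    obtain ⟨k, hk, htil⟩ := hn₀ n hn G hG
    refine ⟨k, lt_of_le_of_lt ?_ hk, htil⟩
    have h1 : min ε (1 / 2) ≤ ε := min_le_left _ _
    have h2 : 0 ≤ α / ((s : ℝ) + (t : ℝ)) := div_nonneg hα.1.le (by positivity)
    gcongr
end

section
/- Let t > s ≥ 1 be integers, α ∈ (0,1), and ε > 0. Then there exist ε' = ε'(s,t,α,ε) > 0 and h = h(s,t,α,ε) > 0 such that the following holds. Suppose G is an n-vertex graph with n ≥ h and e(G) ≥ T_{s,t}(α)·C(n,2), and F is a K_{s,t}-tiling in G of maximum size with |F| ≤ (1−ε)αn. Then at least one of the following holds: (i) there exists an F₁-tiling F' in G with |F'| ≥ |F| + ε'n, where F₁ = {K_{s,t}, K_{s,t−1}, K_2}; or (ii) there exists an F-augmentation (E₀, E₁) such that E₀ contains at least ε'n edges. -/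
/-- The complete bipartite graph `K_{s,t}`. -/
abbrev Kst (s t : ℕ) : SimpleGraph (Fin s ⊕ Fin t) :=
  completeBipartiteGraph (Fin s) (Fin t)

/-- A `K_{s,t}`-tiling in `G` consisting of `r` copies: a family of `r`
injective homomorphisms of `K_{s,t}` into `G` with pairwise disjoint images. -/
structure KstTiling (s t : ℕ) {V : Type*} (G : SimpleGraph V) (r : ℕ) where
  f : Fin r → Fin s ⊕ Fin t → V
  inj : ∀ i, Function.Injective (f i)
  hom : ∀ i u v, (Kst s t).Adj u v → G.Adj (f i u) (f i v)
  disj : ∀ i j : Fin r, i ≠ j → ∀ u v, f i u ≠ f j v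

namespace KstTiling

variable {s t : ℕ} {V : Type*} {G : SimpleGraph V} {r : ℕ}

/-- `v` is covered by the tiling `F`. -/
def covered (F : KstTiling s t G r) (v : V) : Prop := ∃ i u, F.f i u = v

/-- `v` belongs to `V₁(K)` for the `i`-th copy `K` of the tiling `F`
(the color class of size `s`). -/
def inV1 (F : KstTiling s t G r) (i : Fin r) (v : V) : Prop :=
  ∃ u : Fin s, F.f i (Sum.inl u) = v

/-- `v` belongs to `V₂(K)` for the `i`-th copy `K` of the tiling `F`
(the color class of size `t`). -/
def inV2 (F : KstTiling s t G r) (i : Fin r) (v : V) : Prop :=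
  ∃ u : Fin t, F.f i (Sum.inr u) = v

end KstTiling

/-- An `𝓕₁`-tiling, where `𝓕₁ = {K_{s,t}, K_{s,t-1}, K₂}`:  pairwise
vertex-disjoint copies of `K_{s,t}` (there are `k₁` of them), of `K_{s,t-1}`
(`k₂` of them) and of `K₂ = K_{1,1}` (`k₃` of them) in `G`. -/
structure F1Tiling (s t : ℕ) {V : Type*} (G : SimpleGraph V) (k₁ k₂ k₃ : ℕ) where
  f₁ : Fin k₁ → Fin s ⊕ Fin t → V
  f₂ : Fin k₂ → Fin s ⊕ Fin (t - 1) → V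
  f₃ : Fin k₃ → Fin 1 ⊕ Fin 1 → V
  inj₁ : ∀ i, Function.Injective (f₁ i)
  inj₂ : ∀ i, Function.Injective (f₂ i)
  inj₃ : ∀ i, Function.Injective (f₃ i)
  hom₁ : ∀ i u v, (Kst s t).Adj u v → G.Adj (f₁ i u) (f₁ i v)
  hom₂ : ∀ i u v, (Kst s (t - 1)).Adj u v → G.Adj (f₂ i u) (f₂ i v)
  hom₃ : ∀ i u v, (Kst 1 1).Adj u v → G.Adj (f₃ i u) (f₃ i v)
  disj₁₁ : ∀ i j : Fin k₁, i ≠ j → ∀ u v, f₁ i u ≠ f₁ j v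
  disj₂₂ : ∀ i j : Fin k₂, i ≠ j → ∀ u v, f₂ i u ≠ f₂ j v
  disj₃₃ : ∀ i j : Fin k₃, i ≠ j → ∀ u v, f₃ i u ≠ f₃ j v
  disj₁₂ : ∀ i j, ∀ u v, f₁ i u ≠ f₂ j v
  disj₁₃ : ∀ i j, ∀ u v, f₁ i u ≠ f₃ j v
  disj₂₃ : ∀ i j, ∀ u v, f₂ i u ≠ f₃ j v

/-- The pair `(e₀, e₁)` is an `F`-augmentation with `|E₀| = p` and `|E₁| = q`
edges:  `E₀` is a matching between `V(G) ∖ V(F)` and `V₁(F)`, `E₁` is a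
matching inside `V₂(F)`, each copy of `F` has at most one vertex matched by
`E₀` and at most one vertex matched by `E₁`, and every copy having a vertex
matched by `E₀` also has a vertex matched by `E₁`. -/
def IsAugmentation {s t r p q : ℕ} {V : Type*} {G : SimpleGraph V}
    (F : KstTiling s t G r) (e₀ : Fin p → V × V) (e₁ : Fin q → V × V) : Prop :=
  -- `E₀` consists of edges of `G` from uncovered vertices to `V₁(F)`,
  -- forming a matching
  (∀ j, G.Adj (e₀ j).1 (e₀ j).2) ∧
  (∀ j, ¬ F.covered (e₀ j).1) ∧
  (∀ j, ∃ i, F.inV1 i (e₀ j).2) ∧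
  Function.Injective (fun x : Fin p × Bool => if x.2 then (e₀ x.1).1 else (e₀ x.1).2) ∧
  -- `E₁` consists of edges of `G` inside `V₂(F)`, forming a matching
  (∀ j, G.Adj (e₁ j).1 (e₁ j).2) ∧
  (∀ j, (∃ i, F.inV2 i (e₁ j).1) ∧ (∃ i, F.inV2 i (e₁ j).2)) ∧
  Function.Injective (fun x : Fin q × Bool => if x.2 then (e₁ x.1).1 else (e₁ x.1).2) ∧
  -- each copy of `F` has at most one vertex matched by `E₀`
  (∀ i j j', F.inV1 i (e₀ j).2 → F.inV1 i (e₀ j').2 → j = j') ∧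
  -- each copy of `F` has at most one vertex matched by `E₁`
  (∀ i : Fin r, ∀ j j' : Fin q, ∀ b b' : Bool,
    F.inV2 i (if b then (e₁ j).1 else (e₁ j).2) →
    F.inV2 i (if b' then (e₁ j').1 else (e₁ j').2) →
    (if b then (e₁ j).1 else (e₁ j).2) = (if b' then (e₁ j').1 else (e₁ j').2)) ∧
  -- every copy with a vertex matched by `E₀` has a vertex matched by `E₁`
  (∀ i : Fin r, (∃ j, F.inV1 i (e₀ j).2) →
    ∃ (j : Fin q) (b : Bool), F.inV2 i (if b then (e₁ j).1 else (e₁ j).2))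

open Classical in
/-- Greedy matching lemma with labels. -/
lemma greedy_matching {V Λ : Type*} [Fintype V] (lab : V → Λ) (c : ℕ)
    (hc : ∀ x, (Finset.univ.filter (fun v => lab v = x)).card ≤ c)
    (S : Finset (V × V)) (hS : ∀ e ∈ S, lab e.1 ≠ lab e.2) (k : ℕ) :
    (∃ e : Fin k → V × V, (∀ j, e j ∈ S) ∧
      Function.Injective (fun x : Fin k × Bool => lab (if x.2 then (e x.1).1 else (e x.1).2))) ∨
    S.card ≤ 4 * k * c * Fintype.card V := by
  induction k with
  | zero => exact Or.inl ⟨fun j => j.elim0, fun j => j.elim0, fun x => x.1.elim0⟩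
  | succ k ih =>
    rcases ih with ⟨e, he, hinj⟩ | h
    · let I : Finset Λ := Finset.univ.image
        (fun x : Fin k × Bool => lab (if x.2 then (e x.1).1 else (e x.1).2))
      have hI : I.card ≤ k * 2 := by
        refine Finset.card_image_le.trans ?_
        simp
      let B : Finset V := I.biUnion (fun x => Finset.univ.filter (fun v => lab v = x))
      have hB : B.card ≤ k * 2 * c :=
        (Finset.card_biUnion_le_card_mul _ _ c (fun x _ => hc x)).trans
          (Nat.mul_le_mul_right c hI)
      have hBmem : ∀ v, v ∈ B ↔ lab v ∈ I := by
        intro v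
        simp [B]
      by_cases hex : ∃ a ∈ S, a.1 ∉ B ∧ a.2 ∉ B
      · left
        obtain ⟨a, haS, ha1, ha2⟩ := hex
        rw [hBmem] at ha1 ha2
        have hin : ∀ (j : Fin k) (b : Bool), lab (if b then (e j).1 else (e j).2) ∈ I :=
          fun j b => Finset.mem_image.2 ⟨(j, b), Finset.mem_univ _, rfl⟩
        have hab := hS a haS
        refine ⟨Fin.snoc (α := fun _ => V × V) e a, ?_, ?_⟩
        · intro j
          refine Fin.lastCases ?_ (fun j => ?_) j
          · simpa using haS
          · simpa using he j
        · rintro ⟨j, b⟩ ⟨j', b'⟩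
          have hna : ∀ b : Bool, lab (if b then a.1 else a.2) ∉ I := by
            intro b; cases b <;> simpa
          refine Fin.lastCases ?_ (fun j => ?_) j <;> refine Fin.lastCases ?_ (fun j' => ?_) j'
          · intro h
            simp only [Fin.snoc_last] at h
            cases b <;> cases b'
            · rfl
            · exact absurd h.symm hab
            · exact absurd h hab
            · rfl
          · intro h
            simp only [Fin.snoc_last, Fin.snoc_castSucc] at h
            exact absurd (h ▸ hin j' b') (hna b)
          · intro h
            simp only [Fin.snoc_last, Fin.snoc_castSucc] at h
            exact absurd (h ▸ hin j b) (hna b')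
          · intro h
            simp only [Fin.snoc_castSucc] at h
            have := @hinj (j, b) (j', b') h
            simp_all
      · right
        push Not at hex
        have hsub : S ⊆ (B ×ˢ Finset.univ) ∪ (Finset.univ ×ˢ B) := by
          intro a ha
          simp only [Finset.mem_union, Finset.mem_product, Finset.mem_univ, and_true, true_and]
          by_cases h1 : a.1 ∈ B
          · exact Or.inl h1
          · exact Or.inr (hex a ha h1)
        have h1 := (Finset.card_le_card hsub).trans (Finset.card_union_le _ _)
        rw [Finset.card_product, Finset.card_product, Finset.card_univ] at h1
        calc S.card ≤ B.card * Fintype.card V + Fintype.card V * B.card := h1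
          _ = 2 * Fintype.card V * B.card := by ring
          _ ≤ 2 * Fintype.card V * (k * 2 * c) := Nat.mul_le_mul_left _ hB
          _ = 4 * k * c * Fintype.card V := by ring
          _ ≤ _ := by gcongr; omega
    · right
      exact h.trans (by gcongr; omega)

namespace KstTiling

variable {s t : ℕ} {V : Type*} {G : SimpleGraph V} {r : ℕ}

lemma idx_eq (F : KstTiling s t G r) {i j : Fin r} {u w : Fin s ⊕ Fin t}
    (h : F.f i u = F.f j w) : i = j ∧ u = w := by
  by_cases hij : i = j
  · subst hij
    exact ⟨rfl, F.inj i h⟩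
  · exact absurd h (F.disj i j hij u w)

open Classical in
/-- Label of a vertex: itself if uncovered, the index of its copy if covered. -/
noncomputable def lab (F : KstTiling s t G r) (v : V) : V ⊕ Fin r :=
  if h : F.covered v then Sum.inr h.choose else Sum.inl v

lemma lab_f (F : KstTiling s t G r) (i : Fin r) (u : Fin s ⊕ Fin t) :
    F.lab (F.f i u) = Sum.inr i := by
  have h : F.covered (F.f i u) := ⟨i, u, rfl⟩
  unfold lab
  rw [dif_pos h]
  obtain ⟨w, hw⟩ := h.choose_spec
  rw [(F.idx_eq hw).1]

lemma lab_un (F : KstTiling s t G r) {v : V} (h : ¬ F.covered v) :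
    F.lab v = Sum.inl v := by
  unfold lab
  rw [dif_neg h]

open Classical in
lemma lab_fiber [Fintype V] (F : KstTiling s t G r) (hs : 1 ≤ s) (x : V ⊕ Fin r) :
    (Finset.univ.filter (fun v => F.lab v = x)).card ≤ s + t := by
  rcases x with x | i
  · have : (Finset.univ.filter (fun v => F.lab v = Sum.inl x)) ⊆ {x} := by
      intro v hv
      simp only [Finset.mem_filter, Finset.mem_univ, true_and] at hv
      by_cases h : F.covered v
      · obtain ⟨i, u, rfl⟩ := h
        rw [lab_f] at hv
        cases hv
      · rw [lab_un F h] at hv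
        simpa using hv
    have := Finset.card_le_card this
    simp only [Finset.card_singleton] at this
    omega
  · have : (Finset.univ.filter (fun v => F.lab v = Sum.inr i)) ⊆
        Finset.univ.image (F.f i) := by
      intro v hv
      simp only [Finset.mem_filter, Finset.mem_univ, true_and] at hv
      by_cases h : F.covered v
      · obtain ⟨j, u, rfl⟩ := h
        rw [lab_f] at hv
        cases hv
        simp
      · rw [lab_un F h] at hv
        cases hv
    refine (Finset.card_le_card this).trans (Finset.card_image_le.trans ?_)
    simp

end KstTiling

open Classical in
/-- A large labelled matching from uncovered vertices to uncovered vertices or `V₂(F)`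
gives a large `𝓕₁`-tiling. -/
lemma f1_of_matching {s t r n k : ℕ} (ht : 1 ≤ t) {G : SimpleGraph (Fin n)}
    (F : KstTiling s t G r) (e : Fin k → Fin n × Fin n)
    (hadj : ∀ j, G.Adj (e j).1 (e j).2)
    (h1 : ∀ j, ¬ F.covered (e j).1)
    (h2 : ∀ j, ¬ F.covered (e j).2 ∨ ∃ i, F.inV2 i (e j).2)
    (hinj : Function.Injective
      (fun x : Fin k × Bool => F.lab (if x.2 then (e x.1).1 else (e x.1).2))) :
    ∃ k₁ k₂ k₃ : ℕ, Nonempty (F1Tiling s t G k₁ k₂ k₃) ∧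
      r * (s + t) + k ≤ k₁ * (s + t) + k₂ * (s + t - 1) + 2 * k₃ := by
  obtain ⟨t', rfl⟩ : ∃ t', t = t' + 1 := ⟨t - 1, by omega⟩
  let T : Finset (Fin r) := Finset.univ.filter (fun i => ∃ j, F.inV2 i (e j).2)
  have hT : ∀ i : T, ∃ w : Fin (t' + 1), ∃ j, F.f i (Sum.inr w) = (e j).2 := by
    rintro ⟨i, hi⟩
    obtain ⟨j, w, hw⟩ := (Finset.mem_filter.1 hi).2
    exact ⟨w, j, hw⟩
  choose w jj hw using hT
  have hTk : T.card ≤ k := by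
    have : Function.Injective jj := by
      intro a b hab
      have h1 := hw a
      rw [hab, ← hw b] at h1
      exact Subtype.ext (F.idx_eq h1).1
    simpa using Fintype.card_le_of_injective jj this
  -- endpoints with a label `inr i` are the removed vertices
  have key : ∀ j (b : Bool) (i : Fin r) u,
      F.f i u = (if b then (e j).1 else (e j).2) →
        ∃ h : i ∈ T, u = Sum.inr (w ⟨i, h⟩) := by
    intro j b i u hu
    cases b with
    | true =>
      simp only [if_true] at hu
      exact absurd ⟨i, u, hu⟩ (h1 j)
    | false =>
      simp only [Bool.false_eq_true, if_false] at hu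
      rcases h2 j with h | ⟨i', u', hu'⟩
      · exact absurd ⟨i, u, hu⟩ h
      · have hii := F.idx_eq (hu.trans hu'.symm)
        have hiT : i ∈ T := by
          simp only [T, Finset.mem_filter, Finset.mem_univ, true_and]
          exact ⟨j, u', by rw [hii.1]; exact hu'⟩
        refine ⟨hiT, ?_⟩
        have hj : jj ⟨i, hiT⟩ = j := by
          have hx : F.lab (e (jj ⟨i, hiT⟩)).2 = F.lab (e j).2 := by
            rw [← hw, ← hu, F.lab_f, F.lab_f]
          have := @hinj (jj ⟨i, hiT⟩, false) (j, false) (by simpa using hx)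
          exact (Prod.ext_iff.1 this).1
        have := hw ⟨i, hiT⟩
        rw [hj, ← hu] at this
        exact (F.idx_eq this).2.symm
  let φ₁ : Fin (Tᶜ).card ≃ (Tᶜ : Finset (Fin r)) := (Finset.equivFin _).symm
  let φ₂ : Fin T.card ≃ T := (Finset.equivFin _).symm
  let g₂ : T → Fin s ⊕ Fin t' → Fin s ⊕ Fin (t' + 1) := fun i => Sum.map id (w i).succAbove
  have hg₂ : ∀ i, Function.Injective (g₂ i) := fun i =>
    Function.Injective.sumMap Function.injective_id Fin.succAbove_right_injective
  have hg₂w : ∀ i u, g₂ i u ≠ Sum.inr (w i) := by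
    rintro i (u | u) h
    · cases h
    · exact Fin.succAbove_ne _ _ (Sum.inr.inj h)
  let q : Fin k → Fin 1 ⊕ Fin 1 → Fin n := fun j => Sum.elim (fun _ => (e j).1) (fun _ => (e j).2)
  have hq : ∀ j u, ∃ b : Bool, q j u = (if b then (e j).1 else (e j).2) := by
    rintro j (u | u)
    · exact ⟨true, rfl⟩
    · exact ⟨false, rfl⟩
  refine ⟨(Tᶜ).card, T.card, k, ⟨⟨fun i => F.f (φ₁ i), fun i u => F.f (φ₂ i) (g₂ (φ₂ i) u), q,
    fun i => F.inj _, fun i => (F.inj _).comp (hg₂ _), ?_, fun i => F.hom _, ?_, ?_, ?_, ?_, ?_,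
    ?_, ?_, ?_⟩⟩, ?_⟩
  · rintro j (u | u) (v | v) h
    · rw [Subsingleton.elim u v]
    · exact absurd h (hadj j).ne
    · exact absurd h (hadj j).ne'
    · rw [Subsingleton.elim u v]
  · rintro i (u | u) (v | v) h
    · simp at h
    · exact F.hom _ _ _ (by simp [g₂])
    · exact F.hom _ _ _ (by simp [g₂])
    · simp at h
  · rintro j (u | u) (v | v) h
    · simp at h
    · exact hadj j
    · exact (hadj j).symm
    · simp at h
  · intro i j hij u v h
    exact hij (φ₁.injective (Subtype.ext (F.idx_eq h).1))
  · intro i j hij u v h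
    exact hij (φ₂.injective (Subtype.ext (F.idx_eq h).1))
  · intro i j hij u v h
    obtain ⟨b, hb⟩ := hq i u
    obtain ⟨b', hb'⟩ := hq j v
    have := @hinj (i, b) (j, b') (by simp only; rw [← hb, ← hb', h])
    exact hij (Prod.ext_iff.1 this).1
  · intro i j u v h
    have h3 := (F.idx_eq h).1
    have h4 := (φ₁ i).2
    rw [h3, Finset.mem_compl] at h4
    exact h4 (φ₂ j).2
  · intro i j u v h
    obtain ⟨b, hb⟩ := hq j v
    obtain ⟨h3, -⟩ := key j b _ u (h.trans hb)
    exact (Finset.mem_compl.1 (φ₁ i).2) h3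
  · intro i j u v h
    obtain ⟨b, hb⟩ := hq j v
    obtain ⟨h3, h4⟩ := key j b _ _ (h.trans hb)
    exact hg₂w _ _ h4
  · have hc : (Tᶜ).card + T.card = r := by
      rw [Finset.card_compl_add_card]; simp
    have : s + (t' + 1) - 1 = s + t' := by omega
    rw [this]
    calc r * (s + (t' + 1)) + k = ((Tᶜ).card + T.card) * (s + (t' + 1)) + k := by rw [hc]
      _ = (Tᶜ).card * (s + (t' + 1)) + T.card * (s + t') + (T.card + k) := by ring
      _ ≤ _ := by omega

open Classical in
/-- A large labelled matching inside `V₂(F)` touching heavy copies gives an augmentation. -/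
lemma aug_of_matching {s t r n k : ℕ} {G : SimpleGraph (Fin n)}
    (F : KstTiling s t G r) (e : Fin k → Fin n × Fin n)
    (hadj : ∀ j, G.Adj (e j).1 (e j).2)
    (h1 : ∀ j, ∃ i, F.inV2 i (e j).1 ∧ ∃ a, F.inV1 i a ∧
      k ≤ (Finset.univ.filter (fun v => ¬ F.covered v ∧ G.Adj a v)).card)
    (h2 : ∀ j, ∃ i, F.inV2 i (e j).2)
    (hinj : Function.Injective
      (fun x : Fin k × Bool => F.lab (if x.2 then (e x.1).1 else (e x.1).2))) :
    ∃ e₀ : Fin k → Fin n × Fin n, IsAugmentation F e₀ e := by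
  choose i hi a ha hk using h1
  let N : Fin k → Finset (Fin n) := fun j =>
    Finset.univ.filter (fun v => ¬ F.covered v ∧ G.Adj (a j) v)
  obtain ⟨b, hbinj, hb⟩ := (Finset.all_card_le_biUnion_card_iff_exists_injective N).1 (by
    intro S
    rcases S.eq_empty_or_nonempty with rfl | ⟨j, hj⟩
    · simp
    · calc S.card ≤ k := by simpa using Finset.card_le_univ S
        _ ≤ (N j).card := hk j
        _ ≤ _ := Finset.card_le_card (Finset.subset_biUnion_of_mem N hj))
  have hb' : ∀ j, ¬ F.covered (b j) ∧ G.Adj (a j) (b j) := fun j => by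
    simpa [N] using hb j
  have hinj' : ∀ (j : Fin k) (b : Bool) (j' : Fin k) (b' : Bool), F.lab (if b then (e j).1 else (e j).2) =
      F.lab (if b' then (e j').1 else (e j').2) → j = j' ∧ b = b' := by
    intro j b j' b' h
    have := @hinj (j, b) (j', b') h
    exact ⟨(Prod.ext_iff.1 this).1, (Prod.ext_iff.1 this).2⟩
  have hlab1 : ∀ j, F.lab (e j).1 = Sum.inr (i j) := by
    intro j
    obtain ⟨u, hu⟩ := hi j
    rw [← hu, F.lab_f]
  have hiinj : Function.Injective i := by
    intro j j' h
    exact (hinj' j true j' true (by simp [hlab1, h])).1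
  have hV1 : ∀ {x y v}, F.inV1 x v → F.inV1 y v → x = y := by
    rintro x y v ⟨u, hu⟩ ⟨u', hu'⟩
    exact (F.idx_eq (hu.trans hu'.symm)).1
  have hacov : ∀ j, F.covered (a j) := by
    intro j
    obtain ⟨u, hu⟩ := ha j
    exact ⟨_, _, hu⟩
  refine ⟨fun j => (b j, a j), fun j => (hb' j).2.symm, fun j => (hb' j).1,
    fun j => ⟨i j, ha j⟩, ?_, hadj, fun j => ⟨⟨i j, hi j⟩, h2 j⟩, ?_, ?_, ?_, ?_⟩
  · rintro ⟨j, c⟩ ⟨j', c'⟩ h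
    cases c <;> cases c' <;> simp only [Bool.false_eq_true, if_true, if_false] at h
    · rw [hiinj (hV1 (ha j) (h ▸ ha j'))]
    · exact absurd (h ▸ hacov j) (hb' j').1
    · exact absurd (h ▸ hacov j') (hb' j).1
    · rw [hbinj h]
  · intro x y h
    exact hinj (congrArg F.lab h)
  · intro x j j' h h'
    exact hiinj ((hV1 (ha j) h).trans (hV1 h' (ha j')))
  · rintro x j j' c c' ⟨u, hu⟩ ⟨u', hu'⟩
    obtain ⟨rfl, rfl⟩ := hinj' j c j' c' (by rw [← hu, ← hu', F.lab_f, F.lab_f])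
    rfl
  · rintro x ⟨j, hj⟩
    refine ⟨j, true, ?_⟩
    rw [hV1 hj (ha j)]
    exact hi j

/-- Union bound for eleven sets. -/
lemma card_le_eleven {β : Type*} [DecidableEq β] {D A B C E I J K M N P Q : Finset β}
    (h : D ⊆ A ∪ (B ∪ (C ∪ (E ∪ (I ∪ (J ∪ (K ∪ (M ∪ (N ∪ (P ∪ Q)))))))))) :
    D.card ≤ A.card + (B.card + (C.card + (E.card + (I.card + (J.card + (K.card + (M.card +
      (N.card + (P.card + Q.card))))))))) := by
  refine (Finset.card_le_card h).trans ?_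
  iterate 10 refine (Finset.card_union_le _ _).trans (Nat.add_le_add_left ?_ _)
  exact le_rfl

set_option maxHeartbeats 1000000 in
open Classical in
/-- The counting step. -/
lemma count_edges {s t r n k : ℕ} (hs : 1 ≤ s) (ht : 1 ≤ t) {G : SimpleGraph (Fin n)}
    (F : KstTiling s t G r) :
    (∃ k₁ k₂ k₃ : ℕ, Nonempty (F1Tiling s t G k₁ k₂ k₃) ∧
      r * (s + t) + k ≤ k₁ * (s + t) + k₂ * (s + t - 1) + 2 * k₃) ∨
    (∃ e₀ e₁ : Fin k → Fin n × Fin n, IsAugmentation F e₀ e₁) ∨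
    (∃ a b l : ℕ, a + b = r ∧ l + r * (s + t) = n ∧
      2 * G.edgeSet.ncard ≤ (r * s) * (r * s) + 2 * ((r * s) * (r * t)) + (b * t) * (b * t)
        + 2 * ((a * s) * l) + 2 * ((r * s) * k) + 4 * (4 * k * (s + t) * n) + r * (t * t)) := by
  let deg : Fin n → ℕ := fun x => (Finset.univ.filter (fun v => ¬ F.covered v ∧ G.Adj x v)).card
  let heavy : Fin r → Prop := fun i => ∃ a, F.inV1 i a ∧ k ≤ deg a
  let S1 : Finset (Fin n × Fin n) := Finset.univ.filter (fun p => G.Adj p.1 p.2 ∧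
    ¬ F.covered p.1 ∧ (¬ F.covered p.2 ∨ ∃ i, F.inV2 i p.2))
  let S2 : Finset (Fin n × Fin n) := Finset.univ.filter (fun p => G.Adj p.1 p.2 ∧
    (∃ i, F.inV2 i p.1 ∧ heavy i ∧ ∃ j, F.inV2 j p.2 ∧ i ≠ j))
  have g1 := greedy_matching F.lab (s + t) (fun x => by convert F.lab_fiber hs x) S1 (by
    rintro ⟨x, y⟩ h
    simp only [S1, Finset.mem_filter, Finset.mem_univ, true_and] at h
    obtain ⟨hadj, hx, hy⟩ := h
    simp only
    rw [F.lab_un hx]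
    rcases hy with hy | ⟨i, u, rfl⟩
    · rw [F.lab_un hy]
      intro h
      exact hadj.ne (Sum.inl.inj h)
    · rw [F.lab_f]
      exact Sum.inl_ne_inr) k
  rcases g1 with ⟨e, he, hinj⟩ | g1
  · left
    simp only [S1, Finset.mem_filter, Finset.mem_univ, true_and] at he
    exact f1_of_matching ht F e (fun j => (he j).1) (fun j => (he j).2.1) (fun j => (he j).2.2) hinj
  have g2 := greedy_matching F.lab (s + t) (fun x => by convert F.lab_fiber hs x) S2 (by
    rintro ⟨x, y⟩ h
    simp only [S2, Finset.mem_filter, Finset.mem_univ, true_and] at h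
    obtain ⟨hadj, i, ⟨u, rfl⟩, -, j, ⟨u', rfl⟩, hij⟩ := h
    simp only
    rw [F.lab_f, F.lab_f]
    intro h
    exact hij (Sum.inr.inj h)) k
  rcases g2 with ⟨e, he, hinj⟩ | g2
  · right; left
    simp only [S2, Finset.mem_filter, Finset.mem_univ, true_and] at he
    obtain ⟨e₀, h⟩ := aug_of_matching F e (fun j => (he j).1)
      (fun j => by
        obtain ⟨-, i, hi, ⟨a, ha⟩, -⟩ := he j
        exact ⟨i, hi, a, ha⟩)
      (fun j => by
        obtain ⟨-, i, hi, -, j', hj', -⟩ := he j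
        exact ⟨j', hj'⟩) hinj
    exact ⟨e₀, e, h⟩
  right; right
  let H : Finset (Fin r) := Finset.univ.filter heavy
  let P1 : Finset (Fin r) → Finset (Fin n) := fun I =>
    (I ×ˢ (Finset.univ : Finset (Fin s))).image (fun x => F.f x.1 (Sum.inl x.2))
  let P2 : Finset (Fin r) → Finset (Fin n) := fun I =>
    (I ×ˢ (Finset.univ : Finset (Fin t))).image (fun x => F.f x.1 (Sum.inr x.2))
  let L : Finset (Fin n) := Finset.univ.filter (fun v => ¬ F.covered v)
  have hP1c : ∀ I, (P1 I).card ≤ I.card * s := fun I =>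
    Finset.card_image_le.trans (by simp)
  have hP2c : ∀ I, (P2 I).card ≤ I.card * t := fun I =>
    Finset.card_image_le.trans (by simp)
  have hP1 : ∀ I v, v ∈ P1 I ↔ ∃ i ∈ I, ∃ u, F.f i (Sum.inl u) = v := by
    intro I v; simp [P1]
  have hP2 : ∀ I v, v ∈ P2 I ↔ ∃ i ∈ I, ∃ u, F.f i (Sum.inr u) = v := by
    intro I v; simp [P2]
  have hL : ∀ v, v ∈ L ↔ ¬ F.covered v := by intro v; simp [L]
  have hLc : L.card + r * (s + t) = n := by
    have h1 : (Finset.univ.filter (fun v => F.covered v)).card = r * (s + t) := by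
      have : Finset.univ.filter (fun v => F.covered v) =
          Finset.univ.image (fun x : Fin r × (Fin s ⊕ Fin t) => F.f x.1 x.2) := by
        ext v
        simp [KstTiling.covered]
      rw [this, Finset.card_image_of_injective]
      · simp
      · rintro ⟨i, u⟩ ⟨j, w⟩ h
        obtain ⟨rfl, rfl⟩ := F.idx_eq h
        rfl
    have h2 := Finset.card_filter_add_card_filter_not (s := (Finset.univ : Finset (Fin n)))
      (fun v => F.covered v)
    simp only [Finset.card_univ, Fintype.card_fin] at h2
    simp only [L]
    omega
  let Low : Finset (Fin n × Fin n) :=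
    (P1 Finset.univ).biUnion (fun x => if k ≤ deg x then ∅ else
      (Finset.univ.filter (fun v => ¬ F.covered v ∧ G.Adj x v)).image (fun v => (x, v)))
  have hLow : Low.card ≤ (r * s) * k := by
    refine (Finset.card_biUnion_le_card_mul _ _ k ?_).trans
      (Nat.mul_le_mul_right k ((hP1c _).trans (by simp)))
    intro x _
    split_ifs with h
    · simp
    · refine Finset.card_image_le.trans ?_
      simp only [deg] at h
      omega
  let Same : Finset (Fin n × Fin n) :=
    (Finset.univ : Finset (Fin r × (Fin t × Fin t))).image
      (fun x => (F.f x.1 (Sum.inr x.2.1), F.f x.1 (Sum.inr x.2.2)))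
  have hSame : Same.card ≤ r * (t * t) := Finset.card_image_le.trans (by simp)
  let D : Finset (Fin n × Fin n) := Finset.univ.filter (fun p => G.Adj p.1 p.2)
  have hD : D.card = 2 * G.edgeSet.ncard := by
    rw [Set.ncard_eq_toFinset_card', ← SimpleGraph.edgeFinset,
      ← SimpleGraph.sum_degrees_eq_twice_card_edges]
    have : D = ((Finset.univ : Finset (Fin n)).sigma (fun x => G.neighborFinset x)).map
        (Equiv.sigmaEquivProd _ _).toEmbedding := by
      ext ⟨x, y⟩
      simp [D]
    rw [this, Finset.card_map, Finset.card_sigma]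
    rfl
  let sw : Finset (Fin n × Fin n) → Finset (Fin n × Fin n) := fun S => S.image Prod.swap
  have hsw : ∀ S, (sw S).card ≤ S.card := fun S => Finset.card_image_le
  have hswm : ∀ S (x y : Fin n), (y, x) ∈ S → (x, y) ∈ sw S := fun S x y h =>
    Finset.mem_image.2 ⟨(y, x), h, rfl⟩
  let U := (Finset.univ : Finset (Fin r))
  have hcl : ∀ v, v ∈ P1 U ∨ v ∈ P2 U ∨ v ∈ L := by
    intro v
    by_cases h : F.covered v
    · obtain ⟨i, u | u, rfl⟩ := h
      · exact Or.inl ((hP1 _ _).2 ⟨i, Finset.mem_univ _, u, rfl⟩)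
      · exact Or.inr (Or.inl ((hP2 _ _).2 ⟨i, Finset.mem_univ _, u, rfl⟩))
    · exact Or.inr (Or.inr ((hL v).2 h))
  have c1L : ∀ x y, G.Adj x y → x ∈ P1 U → y ∈ L → (x, y) ∈ (P1 H ×ˢ L) ∪ Low := by
    intro x y hxy hx hy
    rw [Finset.mem_union]
    by_cases hd : k ≤ deg x
    · left
      obtain ⟨i, -, u, hu⟩ := (hP1 _ _).1 hx
      refine Finset.mem_product.2 ⟨(hP1 _ _).2 ⟨i, ?_, u, hu⟩, hy⟩
      simp only [H, Finset.mem_filter, Finset.mem_univ, true_and]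
      exact ⟨x, ⟨u, hu⟩, hd⟩
    · right
      refine Finset.mem_biUnion.2 ⟨x, hx, ?_⟩
      rw [if_neg hd]
      refine Finset.mem_image.2 ⟨y, ?_, rfl⟩
      simp only [Finset.mem_filter, Finset.mem_univ, true_and]
      exact ⟨(hL y).1 hy, hxy⟩
  have cLL : ∀ x y, G.Adj x y → x ∈ L → (y ∈ P2 U ∨ y ∈ L) → (x, y) ∈ S1 := by
    intro x y hxy hx hy
    simp only [S1, Finset.mem_filter, Finset.mem_univ, true_and]
    refine ⟨hxy, (hL x).1 hx, ?_⟩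
    rcases hy with hy | hy
    · obtain ⟨i, -, u, hu⟩ := (hP2 _ _).1 hy
      exact Or.inr ⟨i, u, hu⟩
    · exact Or.inl ((hL y).1 hy)
  have c22 : ∀ x y, G.Adj x y → x ∈ P2 U → y ∈ P2 U →
      (x, y) ∈ S2 ∨ (x, y) ∈ sw S2 ∨ (x, y) ∈ Same ∨ (x, y) ∈ P2 Hᶜ ×ˢ P2 Hᶜ := by
    intro x y hxy hx hy
    obtain ⟨i, -, u, rfl⟩ := (hP2 _ _).1 hx
    obtain ⟨j, -, w, rfl⟩ := (hP2 _ _).1 hy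
    by_cases hij : i = j
    · subst hij
      right; right; left
      exact Finset.mem_image.2 ⟨(i, u, w), Finset.mem_univ _, rfl⟩
    by_cases hi : heavy i
    · left
      simp only [S2, Finset.mem_filter, Finset.mem_univ, true_and]
      exact ⟨hxy, i, ⟨u, rfl⟩, hi, j, ⟨w, rfl⟩, hij⟩
    by_cases hj : heavy j
    · right; left
      apply hswm
      simp only [S2, Finset.mem_filter, Finset.mem_univ, true_and]
      exact ⟨hxy.symm, j, ⟨w, rfl⟩, hj, i, ⟨u, rfl⟩, Ne.symm hij⟩
    · right; right; right
      refine Finset.mem_product.2 ⟨(hP2 _ _).2 ⟨i, ?_, u, rfl⟩, (hP2 _ _).2 ⟨j, ?_, w, rfl⟩⟩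
      · simpa [H] using hi
      · simpa [H] using hj
  have hcover : D ⊆ (P1 U ×ˢ P1 U) ∪ ((P1 U ×ˢ P2 U) ∪ ((P2 U ×ˢ P1 U) ∪ (S1 ∪ (sw S1 ∪
      (((P1 H ×ˢ L) ∪ Low) ∪ (sw ((P1 H ×ˢ L) ∪ Low) ∪ (S2 ∪ (sw S2 ∪ (Same ∪
        (P2 Hᶜ ×ˢ P2 Hᶜ)))))))))) := by
    rintro ⟨x, y⟩ hxy
    have hxy : G.Adj x y := by simpa [D] using hxy
    have m12 := fun A B => @Finset.mem_product _ _ A B (x, y)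
    rw [Finset.mem_union, Finset.mem_union, Finset.mem_union, Finset.mem_union, Finset.mem_union,
      Finset.mem_union (s := (P1 H ×ˢ L) ∪ Low), Finset.mem_union (s := sw ((P1 H ×ˢ L) ∪ Low)),
      Finset.mem_union (s := S2), Finset.mem_union (s := sw S2), Finset.mem_union (s := Same),
      m12 (P1 U), m12 (P1 U), m12 (P2 U)]
    simp only
    rcases hcl x with hx | hx | hx <;> rcases hcl y with hy | hy | hy
    · exact Or.inl (⟨hx, hy⟩)
    · exact Or.inr (Or.inl (⟨hx, hy⟩))
    · exact Or.inr (Or.inr (Or.inr (Or.inr (Or.inr (Or.inl (c1L x y hxy hx hy))))))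
    · exact Or.inr (Or.inr (Or.inl (⟨hx, hy⟩)))
    · rcases c22 x y hxy hx hy with h | h | h | h
      · exact Or.inr (Or.inr (Or.inr (Or.inr (Or.inr (Or.inr (Or.inr (Or.inl (h))))))))
      · exact Or.inr (Or.inr (Or.inr (Or.inr (Or.inr (Or.inr (Or.inr (Or.inr (Or.inl (h)))))))))
      · exact Or.inr (Or.inr (Or.inr (Or.inr (Or.inr (Or.inr (Or.inr (Or.inr (Or.inr (Or.inl (h))))))))))
      · exact Or.inr (Or.inr (Or.inr (Or.inr (Or.inr (Or.inr (Or.inr (Or.inr (Or.inr (Or.inr (h))))))))))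
    · exact Or.inr (Or.inr (Or.inr (Or.inr (Or.inl (hswm _ _ _ (cLL y x hxy.symm hy (Or.inl hx)))))))
    · exact Or.inr (Or.inr (Or.inr (Or.inr (Or.inr (Or.inr (Or.inl (hswm _ _ _ (c1L y x hxy.symm hy hx))))))))
    · exact Or.inr (Or.inr (Or.inr (Or.inl (cLL x y hxy hx (Or.inl hy)))))
    · exact Or.inr (Or.inr (Or.inr (Or.inl (cLL x y hxy hx (Or.inr hy)))))
  refine ⟨H.card, (Hᶜ).card, L.card, by rw [Finset.card_add_card_compl]; simp, hLc, ?_⟩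
  rw [← hD]
  have hU : U.card = r := by simp [U]
  have b1 : (P1 U).card ≤ r * s := (hP1c U).trans_eq (by rw [hU])
  have b2 : (P2 U).card ≤ r * t := (hP2c U).trans_eq (by rw [hU])
  have bA : ((P1 H ×ˢ L) ∪ Low).card ≤ (H.card * s) * L.card + (r * s) * k := by
    refine (Finset.card_union_le _ _).trans (Nat.add_le_add ?_ hLow)
    rw [Finset.card_product]
    exact Nat.mul_le_mul_right _ (hP1c H)
  have p11 : (P1 U ×ˢ P1 U).card ≤ (r * s) * (r * s) := by
    rw [Finset.card_product]; exact Nat.mul_le_mul b1 b1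
  have p12 : (P1 U ×ˢ P2 U).card ≤ (r * s) * (r * t) := by
    rw [Finset.card_product]; exact Nat.mul_le_mul b1 b2
  have p21 : (P2 U ×ˢ P1 U).card ≤ (r * s) * (r * t) := by
    rw [Finset.card_product, mul_comm]; exact Nat.mul_le_mul b1 b2
  have p22 : (P2 Hᶜ ×ˢ P2 Hᶜ).card ≤ ((Hᶜ).card * t) * ((Hᶜ).card * t) := by
    rw [Finset.card_product]; exact Nat.mul_le_mul (hP2c _) (hP2c _)
  rw [Fintype.card_fin] at g1 g2
  have hfin := card_le_eleven hcover
  have q1 := (hsw S1).trans g1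
  have q2 := (hsw S2).trans g2
  have q3 := (hsw _).trans bA
  generalize (Hᶜ).card = hb at *
  generalize H.card = ha at *
  generalize L.card = lc at *
  linarith

/-- The numerical step. -/
lemma numeric (s t r n a b l k e β : ℝ) (hs : 1 ≤ s) (ht : 1 ≤ t) (hr : 0 ≤ r) (hn : 0 ≤ n)
    (ha : 0 ≤ a) (hb : 0 ≤ b) (hk : 0 ≤ k) (hab : a + b = r) (hl : l + r * (s + t) = n)
    (hl0 : 0 ≤ l)
    (hβ : r * (s + t) ≤ β * n) (hβ1 : β ≤ 1)
    (he : 2 * e ≤ (r * s) * (r * s) + 2 * ((r * s) * (r * t)) + (b * t) * (b * t)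
        + 2 * ((a * s) * l) + 2 * ((r * s) * k) + 4 * (4 * k * (s + t) * n) + r * (t * t)) :
    2 * e ≤ max (2 * (s / (s + t) * β) - (s / (s + t) * β) ^ 2) (β ^ 2) * n ^ 2 +
      (16 * (s + t) + 2) * k * n + t ^ 2 * n := by
  have hst : 0 < s + t := by linarith
  set M := max (2 * (s / (s + t) * β) - (s / (s + t) * β) ^ 2) (β ^ 2) with hM
  have hM0 : 0 ≤ M := le_max_of_le_right (sq_nonneg _)
  have hrn : r ≤ n := by nlinarith
  have hrsn : r * s ≤ n := by nlinarith
  have hX : ((s + t) * r) ^ 2 ≤ M * n ^ 2 := by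
    calc ((s + t) * r) ^ 2 ≤ (β * n) ^ 2 := by
          apply pow_le_pow_left₀ (by positivity); linarith
      _ = β ^ 2 * n ^ 2 := by ring
      _ ≤ _ := by gcongr; exact le_max_right _ _
  have hY : 2 * s * r * n - s ^ 2 * r ^ 2 ≤ M * n ^ 2 := by
    set p := s / (s + t) with hp
    have hp0 : 0 ≤ p := by positivity
    have hp1 : p ≤ 1 := by rw [hp, div_le_one hst]; linarith
    have hps : p * (s + t) = s := by rw [hp]; field_simp
    have h1 : s * r ≤ p * β * n := by
      rw [← hps]; nlinarith
    have h2 : p * β * n ≤ n := by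
      have : p * β ≤ 1 := by nlinarith
      nlinarith
    calc 2 * s * r * n - s ^ 2 * r ^ 2 = n ^ 2 - (n - s * r) ^ 2 := by ring
      _ ≤ n ^ 2 - (n - p * β * n) ^ 2 := by
          have : (n - p * β * n) ^ 2 ≤ (n - s * r) ^ 2 :=
            pow_le_pow_left₀ (by linarith) (by linarith) 2
          linarith
      _ = (2 * (p * β) - (p * β) ^ 2) * n ^ 2 := by ring
      _ ≤ _ := by gcongr; exact le_max_left _ _
  have hmain : (r * s) * (r * s) + 2 * ((r * s) * (r * t)) + (b * t) * (b * t)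
        + 2 * ((a * s) * l) ≤ M * n ^ 2 := by
    rcases hr.eq_or_lt with h0 | h0
    · have : a = 0 := by linarith
      have : b = 0 := by linarith
      subst_vars
      simp
      positivity
    · refine le_of_mul_le_mul_left ?_ h0
      have hll : l = n - r * (s + t) := by linarith
      have hbr : b * b ≤ r * b := by nlinarith
      calc r * ((r * s) * (r * s) + 2 * ((r * s) * (r * t)) + (b * t) * (b * t)
            + 2 * ((a * s) * l))
          = r * ((r * s) * (r * s) + 2 * ((r * s) * (r * t)) + t ^ 2 * (b * b)
            + 2 * ((a * s) * l)) := by ring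
        _ ≤ r * ((r * s) * (r * s) + 2 * ((r * s) * (r * t)) + t ^ 2 * (r * b)
            + 2 * ((a * s) * l)) := by gcongr
        _ = b * ((s + t) * r) ^ 2 + a * (2 * s * r * n - s ^ 2 * r ^ 2) := by
            rw [hll, ← hab]; ring
        _ ≤ b * (M * n ^ 2) + a * (M * n ^ 2) := by gcongr
        _ = r * (M * n ^ 2) := by rw [← hab]; ring
  have h3 : 2 * ((r * s) * k) ≤ 2 * (n * k) := by gcongr
  have h4 : r * (t * t) ≤ n * (t * t) := by gcongr
  nlinarith

/-- **Main Lemma.**  Let `t > s ≥ 1`, `α ∈ (0,1)`, `ε > 0`.  There exist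
`ε' > 0` and `h` such that for every graph `G` on `n ≥ h` vertices with
`e(G) ≥ T_{s,t}(α)·C(n,2)` and every maximum-size `K_{s,t}`-tiling `F` in `G`
with `|F| ≤ (1-ε)αn`, either
(i) there is an `𝓕₁`-tiling `F'` in `G` with `|F'| ≥ |F| + ε'n`, or
(ii) there is an `F`-augmentation `(E₀,E₁)` with `|E₀| ≥ ε'n`. -/
theorem main_lemma (s t : ℕ) (hs : 1 ≤ s) (hst : s < t)
    (α : ℝ) (hα : α ∈ Set.Ioo (0 : ℝ) 1) (ε : ℝ) (hε : 0 < ε) :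
    ∃ ε' : ℝ, 0 < ε' ∧ ∃ h : ℕ, 0 < h ∧
      ∀ n : ℕ, h ≤ n → ∀ G : SimpleGraph (Fin n),
        Tst s t α * (n.choose 2 : ℝ) ≤ (G.edgeSet.ncard : ℝ) →
        ∀ r : ℕ, ∀ F : KstTiling s t G r,
          (∀ r' : ℕ, Nonempty (KstTiling s t G r') → r' ≤ r) →
          ((r : ℝ) * ((s : ℝ) + (t : ℝ)) ≤ (1 - ε) * α * (n : ℝ)) →
          ((∃ k₁ k₂ k₃ : ℕ, Nonempty (F1Tiling s t G k₁ k₂ k₃) ∧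
              (r : ℝ) * ((s : ℝ) + (t : ℝ)) + ε' * (n : ℝ) ≤
                (k₁ : ℝ) * ((s : ℝ) + (t : ℝ)) +
                (k₂ : ℝ) * ((s : ℝ) + (t : ℝ) - 1) + 2 * (k₃ : ℝ)) ∨
            (∃ (p q : ℕ) (e₀ : Fin p → Fin n × Fin n) (e₁ : Fin q → Fin n × Fin n),
              IsAugmentation F e₀ e₁ ∧ ε' * (n : ℝ) ≤ (p : ℝ))) := by
  obtain ⟨hα0, hα1⟩ := hα
  have hs1 : (1 : ℝ) ≤ s := by exact_mod_cast hs
  have ht1 : (1 : ℝ) ≤ t := by exact_mod_cast (by omega : 1 ≤ t)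
  have hstp : (0 : ℝ) < s + t := by linarith
  set p : ℝ := (s : ℝ) / (s + t) with hp
  have hp0 : 0 < p := by positivity
  have hp1 : p < 1 := by rw [hp, div_lt_one hstp]; linarith
  set β : ℝ := max ((1 - ε) * α) 0 with hβ
  have hβ0 : 0 ≤ β := le_max_right _ _
  have hβα : β < α := max_lt (by nlinarith) hα0
  have hT : Tst s t α = max (2 * (p * α) - (p * α) ^ 2) (α ^ 2) := by
    unfold Tst
    congr 1
    rw [hp]
    field_simp
  set T := Tst s t α with hTdef
  set M : ℝ := max (2 * (p * β) - (p * β) ^ 2) (β ^ 2) with hM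
  have hMT : M < T := by
    rw [hT, hM]
    apply max_lt
    · apply lt_max_of_lt_left
      have h1 : p * β < p * α := by gcongr
      have h2 : p * α < 1 := by nlinarith
      nlinarith
    · apply lt_max_of_lt_right
      nlinarith
  have hT0 : 0 ≤ T := by rw [hT]; exact le_max_of_le_right (sq_nonneg _)
  set η := T - M with hη
  have hη0 : 0 < η := by linarith
  set C : ℝ := 16 * (s + t) + 2 with hC
  have hC0 : 0 < C := by positivity
  obtain ⟨h, hh⟩ := exists_nat_gt (2 * (C + t ^ 2 + T) / η)
  refine ⟨η / (4 * C), by positivity, h + 1, by omega, ?_⟩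
  intro n hn G hG r F _ hr
  have hnh : ((h : ℝ) + 1) ≤ n := by exact_mod_cast hn
  have hh0 : (0 : ℝ) ≤ h := Nat.cast_nonneg h
  have hn0 : (0 : ℝ) < n := by linarith
  have hnη : 2 * (C + t ^ 2 + T) < η * n := by
    rw [div_lt_iff₀ hη0] at hh
    nlinarith
  set k : ℕ := ⌈η / (4 * C) * n⌉₊ with hk
  have hk1 : η / (4 * C) * n ≤ k := Nat.le_ceil _
  have hk2 : (k : ℝ) < η / (4 * C) * n + 1 := Nat.ceil_lt_add_one (by positivity)
  rcases count_edges (k := k) hs (by omega : 1 ≤ t) F with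
    ⟨k₁, k₂, k₃, hF, hsz⟩ | ⟨e₀, e₁, ha⟩ | ⟨a, b, l, hab, hl, hcount⟩
  · left
    refine ⟨k₁, k₂, k₃, hF, ?_⟩
    have : ((r * (s + t) + k : ℕ) : ℝ) ≤
      ((k₁ * (s + t) + k₂ * (s + t - 1) + 2 * k₃ : ℕ) : ℝ) := by exact_mod_cast hsz
    push_cast [Nat.cast_sub (by omega : 1 ≤ s + t)] at this
    linarith
  · right
    exact ⟨k, k, e₀, e₁, ha, hk1⟩
  · exfalso
    have hnum := numeric s t r n a b l k (G.edgeSet.ncard : ℝ) β hs1 ht1 (by positivity)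
      hn0.le (by positivity) (by positivity) (by positivity) (by exact_mod_cast hab)
      (by exact_mod_cast hl) (by positivity)
      (hr.trans (by gcongr; exact le_max_left _ _)) (by linarith) (by exact_mod_cast hcount)
    rw [← hp, ← hM, ← hC] at hnum
    rw [Nat.cast_choose_two] at hG
    have h1 : C * k * n ≤ (η * n / 4 + C) * n := by
      have : C * k ≤ η * n / 4 + C := by
        calc C * k ≤ C * (η / (4 * C) * n + 1) := by gcongr
          _ = _ := by field_simp
      gcongr
    have h2 : 2 * (C + t ^ 2 + T) * n < η * n * n := by gcongr
    have h3 : M = T - η := by rw [hη]; ring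
    rw [h3] at hnum
    nlinarith [mul_pos hη0 (mul_pos hn0 hn0)]
end

section
/- Let H be a bipartite graph with no isolated vertices, s := s(H), t := t(H). For every ε' > 0 and every β ∈ (0, 1/(s+t)) there exists n₀ such that for all n ≥ n₀: every n-vertex graph which contains no ⌈βn⌉ pairwise vertex-disjoint copies of H has at most T_{s,t}(β(s+t))·C(n,2) + ε'·n² edges. Equivalently, ex(n, ⌈βn⌉×H) ≤ T_{s,t}(β(s+t))·C(n,2) + ε'·n² for all sufficiently large n. -/
open Finset in
lemma tl_minimax {E V : Type*} [Fintype E] [Fintype V] [Nonempty E] [Nonempty V]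
    (A : E → V → ℝ) :
    ∃ p ∈ stdSimplex ℝ E, ∃ q ∈ stdSimplex ℝ V, ∃ v : ℝ,
      (∀ i, ∑ e, p e * A e i ≤ v) ∧ (∀ e, v ≤ ∑ i, q i * A e i) := by
  classical
  let f : (E → ℝ) → (V → ℝ) → ℝ := fun p q => ∑ e, ∑ i, p e * q i * A e i
  have hlinx : ∀ q, IsLinearMap ℝ (fun p => f p q) := by
    intro q
    constructor
    · intro x y
      simp only [f, Pi.add_apply, add_mul, Finset.sum_add_distrib]
    · intro c x
      simp only [f, Pi.smul_apply, smul_eq_mul, Finset.mul_sum]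
      refine Finset.sum_congr rfl fun e _ => Finset.sum_congr rfl fun i _ => ?_
      ring
  have hliny : ∀ p, IsLinearMap ℝ (fun q => f p q) := by
    intro q
    constructor
    · intro x y
      simp only [f, Pi.add_apply, mul_add, add_mul, Finset.sum_add_distrib]
    · intro c x
      simp only [f, Pi.smul_apply, smul_eq_mul, Finset.mul_sum]
      refine Finset.sum_congr rfl fun e _ => Finset.sum_congr rfl fun i _ => ?_
      ring
  obtain ⟨p, hp, q, hq, h⟩ := Sion.exists_isSaddlePointOn (X := stdSimplex ℝ E)
    (Y := stdSimplex ℝ V) (f := f)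
    ⟨_, single_mem_stdSimplex ℝ (Classical.arbitrary E)⟩ (convex_stdSimplex ℝ E)
    (isCompact_stdSimplex ℝ E)
    (fun y _ => (show Continuous _ by fun_prop).lowerSemicontinuous.lowerSemicontinuousOn _)
    (fun y _ => ((hlinx y).mk' _ |>.convexOn (convex_stdSimplex ℝ E)).quasiconvexOn)
    (convex_stdSimplex ℝ V) ⟨_, single_mem_stdSimplex ℝ (Classical.arbitrary V)⟩
    (isCompact_stdSimplex ℝ V)
    (fun y _ => (show Continuous _ by fun_prop).upperSemicontinuous.upperSemicontinuousOn _)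
    (fun y _ => ((hliny y).mk' _ |>.concaveOn (convex_stdSimplex ℝ V)).quasiconcaveOn)
  refine ⟨p, hp, q, hq, f p q, ?_, ?_⟩
  · intro i
    have := h p hp _ (single_mem_stdSimplex ℝ i)
    refine le_trans (le_of_eq ?_) this
    simp only [f]
    refine Finset.sum_congr rfl fun e _ => ?_
    simp [Pi.single_apply]
  · intro e
    have := h _ (single_mem_stdSimplex ℝ e) q hq
    refine le_trans this (le_of_eq ?_)
    simp only [f]
    rw [Finset.sum_comm]
    refine Finset.sum_congr rfl fun i _ => ?_
    simp [Pi.single_apply]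

open MeasureTheory in
lemma tl_round {V : Type*} [Fintype V] [DecidableEq V] (r : V → V → Prop) (c : V → ℝ)
    (hc : ∀ i, 0 ≤ c i) (s t : ℝ) (hs : 0 < s) (ht : 0 < t)
    (hr : ∀ i j, r i j → 1 ≤ s * c i + t * c j ∧ 1 ≤ s * c j + t * c i) :
    ∃ A B : Finset V, (∀ i j, r i j → i ∈ A ∨ j ∈ A ∨ (i ∈ B ∧ j ∈ B)) ∧
      (A.card : ℝ) / s + (B.card : ℝ) / (s + t) ≤ ∑ i, c i := by
  classical
  have hst : 0 < s + t := by positivity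
  let η : V → ℝ := fun i => ((s + t) * c i - 1) * s / t
  let μ : V → ℝ := fun i => (s + t) * c i
  let g : V → ℝ → ℝ := fun i x => (Set.Iic (η i)).indicator (fun _ => 1 / s) x +
    (Set.Ioi (η i) ∩ Set.Ici (1 - μ i)).indicator (fun _ => 1 / (s + t)) x
  have hgint : ∀ i, IntegrableOn (g i) (Set.Ioc 0 1) := by
    intro i
    apply Integrable.add
    · exact (integrable_const _).indicator measurableSet_Iic
    · exact (integrable_const _).indicator (measurableSet_Ioi.inter measurableSet_Ici)
  have hgle : ∀ i, ∫ x in Set.Ioc (0:ℝ) 1, g i x ≤ c i := by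
    intro i
    simp only [g]
    rw [integral_add ((integrable_const _).indicator measurableSet_Iic)
      ((integrable_const _).indicator (measurableSet_Ioi.inter measurableSet_Ici)),
      setIntegral_indicator measurableSet_Iic,
      setIntegral_indicator (measurableSet_Ioi.inter measurableSet_Ici)]
    simp only [setIntegral_const, smul_eq_mul]
    have hηeq : c i = 1 / (s + t) + η i * (1 / s - 1 / (s + t)) := by
      simp only [η]; field_simp; ring
    by_cases h0 : 0 ≤ η i
    · have e1 : Set.Ioc (0:ℝ) 1 ∩ Set.Iic (η i) = Set.Ioc 0 (min 1 (η i)) := by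
        ext x; simp
      have e2 : Set.Ioc (0:ℝ) 1 ∩ (Set.Ioi (η i) ∩ Set.Ici (1 - μ i)) ⊆
          Set.Ioc (min 1 (η i)) 1 := by
        intro x; simp; intro h1 h2 h3 h4; exact ⟨Or.inr h3, h2⟩
      have e3 := measureReal_mono (μ := volume) e2 (by simp)
      rw [e1]
      simp only [Real.volume_real_Ioc] at e3 ⊢
      have hm1 : min 1 (η i) ≤ 1 := min_le_left _ _
      have hm2 : min 1 (η i) ≤ η i := min_le_right _ _
      have hm0 : 0 ≤ min 1 (η i) := le_min zero_le_one h0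
      rw [max_eq_left (by linarith)] at e3 ⊢
      have hpos : 0 ≤ 1 / s - 1 / (s + t) := by
        rw [sub_nonneg]; gcongr; linarith
      have hpos2 : 0 ≤ 1 / (s + t) := by positivity
      rw [hηeq]
      nlinarith [mul_le_mul_of_nonneg_right e3 hpos2, mul_le_mul_of_nonneg_right hm2 hpos]
    · push Not at h0
      have hμ1 : μ i < 1 := by
        by_contra hcon
        push Not at hcon
        have : 0 ≤ η i := by
          simp only [η, μ] at *
          apply div_nonneg (mul_nonneg (by linarith) hs.le) ht.le
        linarith
      have hμ0 : 0 ≤ μ i := mul_nonneg hst.le (hc i)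
      have e1 : Set.Ioc (0:ℝ) 1 ∩ Set.Iic (η i) = ∅ := by
        ext x; simp; intro h1 h2; linarith
      have e2 : Set.Ioc (0:ℝ) 1 ∩ (Set.Ioi (η i) ∩ Set.Ici (1 - μ i)) ⊆
          Set.Icc (1 - μ i) 1 := by
        intro x; simp; intro h1 h2 h3 h4; exact ⟨by linarith, h2⟩
      have e3 := measureReal_mono (μ := volume) e2 (by simp)
      rw [e1]
      simp only [Real.volume_real_Icc] at e3
      rw [max_eq_left (by linarith)] at e3
      have hpos2 : 0 ≤ 1 / (s + t) := by positivity
      have : c i = μ i * (1 / (s + t)) := by simp only [μ]; field_simp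
      rw [this]
      have := mul_le_mul_of_nonneg_right e3 hpos2
      simp only [measureReal_empty, zero_mul, zero_add]
      linarith
  obtain ⟨l, ⟨hl0, hl1⟩, hl⟩ := exists_le_setAverage (μ := volume) (s := Set.Ioc (0:ℝ) 1)
    (f := fun x => ∑ i, g i x) (by simp) (by simp)
    (integrable_finsetSum _ fun i _ => hgint i)
  rw [setAverage_eq, integral_finsetSum _ fun i _ => hgint i] at hl
  simp at hl
  refine ⟨Finset.univ.filter fun i => l ≤ η i,
    Finset.univ.filter fun i => η i < l ∧ 1 - μ i ≤ l, ?_, ?_⟩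
  · intro i j hij
    obtain ⟨h1, h2⟩ := hr i j hij
    simp only [Finset.mem_filter, Finset.mem_univ, true_and]
    by_contra! hcon
    obtain ⟨hi, hj, h⟩ := hcon
    have key : ∀ i j, 1 ≤ s * c i + t * c j → η i < l → 1 - μ j ≤ l := by
      intro i j h1 hi
      simp only [η] at hi
      rw [div_lt_iff₀ ht] at hi
      simp only [μ]
      by_contra! hcon
      nlinarith
    have a1 := key i j h1 hi
    have a2 := key j i h2 hj
    have := h ⟨hi, a2⟩ hj
    linarith
  · refine le_trans (le_of_eq ?_) (hl.trans (Finset.sum_le_sum fun i _ => hgle i))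
    simp only [g, Finset.sum_add_distrib, Set.indicator_apply, Finset.sum_ite, Set.mem_Iic,
      Set.mem_inter_iff, Set.mem_Ioi, Set.mem_Ici, Finset.sum_const_zero, add_zero,
      Finset.sum_const, nsmul_eq_mul]
    ring

lemma tl_opt (x y s t θ : ℝ) (hs : 0 < s) (ht : 0 < t) (hy : 0 ≤ y) (hθ : 0 < θ)
    (h1 : s * θ ≤ 1) (hx : 0 ≤ x) (h : x / s + y / (s + t) ≤ θ) :
    2 * x - x ^ 2 + y ^ 2 ≤ max (2 * s * θ - s ^ 2 * θ ^ 2) ((s + t) ^ 2 * θ ^ 2) := by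
  have hst : 0 < s + t := by positivity
  obtain ⟨z, hz⟩ : ∃ z, y = (s + t) * θ * z := ⟨y / ((s + t) * θ), by field_simp⟩
  have hz0 : 0 ≤ z := by
    by_contra! hcon
    have : 0 < (s + t) * θ := by positivity
    nlinarith
  have hxz : x ≤ s * θ * (1 - z) := by
    have e : y / (s + t) = θ * z := by rw [hz]; field_simp
    rw [e] at h
    have : x / s ≤ θ * (1 - z) := by linarith
    rw [div_le_iff₀ hs] at this
    linarith
  have hz1 : z ≤ 1 := by
    by_contra! hcon
    have : 0 < s * θ := by positivity
    nlinarith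
  set X := s * θ * (1 - z) with hX
  have hX1 : X ≤ 1 := by
    have : 0 < s * θ := by positivity
    nlinarith
  have hmono : 2 * x - x ^ 2 ≤ 2 * X - X ^ 2 := by nlinarith
  have hchord : 2 * X - X ^ 2 + y ^ 2 ≤
      (1 - z) * (2 * s * θ - s ^ 2 * θ ^ 2) + z * ((s + t) ^ 2 * θ ^ 2) := by
    rw [hX, hz]
    have : 0 ≤ θ ^ 2 * (z * (1 - z)) * ((s + t) ^ 2 - s ^ 2) := by
      apply mul_nonneg
      · have : 0 ≤ z * (1 - z) := mul_nonneg hz0 (by linarith)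
        positivity
      · nlinarith
    nlinarith
  have a1 := le_max_left (2 * s * θ - s ^ 2 * θ ^ 2) ((s + t) ^ 2 * θ ^ 2)
  have a2 := le_max_right (2 * s * θ - s ^ 2 * θ ^ 2) ((s + t) ^ 2 * θ ^ 2)
  nlinarith [mul_le_mul_of_nonneg_left a1 (by linarith : 0 ≤ 1 - z),
    mul_le_mul_of_nonneg_left a2 hz0]

/-- Number of vertices of the cluster `l` used by a copy placed on the ordered pair `e`. -/
def tlLoad {ι : Type*} [DecidableEq ι] (s t : ℕ) (l : ι) (e : ι × ι) : ℕ :=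
  (if l = e.1 then s else 0) + (if l = e.2 then t else 0)

lemma tl_dichotomy {V : Type*} [Fintype V] [DecidableEq V] (r : V → V → Prop) [DecidableRel r]
    (hsymm : ∀ i j, r i j → r j i) (s t : ℕ) (hs : 0 < s) (ht : 0 < t) (Θ : ℝ) (hΘ : 0 ≤ Θ) :
    (∃ w : {e : V × V // r e.1 e.2} → ℝ, (∀ e, 0 ≤ w e) ∧
      (∀ l, ∑ e, w e * (tlLoad s t l e.1 : ℝ) ≤ 1) ∧ Θ ≤ ∑ e, w e) ∨
    (∃ A B : Finset V, (∀ i j, r i j → i ∈ A ∨ j ∈ A ∨ (i ∈ B ∧ j ∈ B)) ∧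
      (A.card : ℝ) / s + (B.card : ℝ) / (s + t) ≤ Θ) := by
  classical
  have hs' : (0:ℝ) < s := by exact_mod_cast hs
  have ht' : (0:ℝ) < t := by exact_mod_cast ht
  rcases isEmpty_or_nonempty {e : V × V // r e.1 e.2} with hE | hE
  · right
    refine ⟨∅, ∅, ?_, by simpa using hΘ⟩
    intro i j hij
    exact (hE.false ⟨(i, j), hij⟩).elim
  have hV : Nonempty V := ⟨hE.some.1.1⟩
  obtain ⟨p, ⟨hp0, hp1⟩, q, ⟨hq0, hq1⟩, v, hpv, hqv⟩ :=
    tl_minimax (fun (e : {e : V × V // r e.1 e.2}) (l : V) => (tlLoad s t l e.1 : ℝ))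
  have hload : ∀ (c : V → ℝ) (e : V × V), ∑ l, c l * (tlLoad s t l e : ℝ) =
      s * c e.1 + t * c e.2 := by
    intro c e
    simp [tlLoad, mul_add, Finset.sum_add_distrib, mul_comm]
  have hv : 0 < v := by
    have h1 : ∑ l : V, ∑ e, p e * (tlLoad s t l e.1 : ℝ) ≤ ∑ l : V, v :=
      Finset.sum_le_sum fun l _ => hpv l
    rw [Finset.sum_comm] at h1
    have h2 : ∀ e : {e : V × V // r e.1 e.2},
        ∑ l : V, p e * (tlLoad s t l e.1 : ℝ) = p e * (s + t) := by
      intro e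
      have := hload (fun _ => p e) e.1
      rw [this]; ring
    rw [Finset.sum_congr rfl fun e _ => h2 e, ← Finset.sum_mul, hp1] at h1
    simp at h1
    have h3 : (0:ℝ) < Fintype.card V := by exact_mod_cast Fintype.card_pos
    by_contra! hcon
    nlinarith
  by_cases hcase : Θ ≤ 1 / v
  · left
    refine ⟨fun e => p e / v, fun e => div_nonneg (hp0 e) hv.le, ?_, ?_⟩
    · intro l
      have : ∑ e, p e / v * (tlLoad s t l e.1 : ℝ) = (∑ e, p e * (tlLoad s t l e.1 : ℝ)) / v := by
        rw [Finset.sum_div]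
        exact Finset.sum_congr rfl fun e _ => by ring
      rw [this, div_le_one hv]
      exact hpv l
    · rw [← Finset.sum_div, hp1]; exact hcase
  · right
    push Not at hcase
    obtain ⟨A, B, hAB, hcost⟩ := tl_round r (fun i => q i / v) (fun i => div_nonneg (hq0 i) hv.le)
      s t hs' ht' (by
        have key : ∀ i j, r i j → 1 ≤ (s:ℝ) * (q i / v) + t * (q j / v) := by
          intro i j hij
          have := hqv ⟨(i, j), hij⟩
          rw [hload] at this
          rw [← mul_div_assoc, ← mul_div_assoc, ← add_div, le_div_iff₀ hv]
          simpa using this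
        exact fun i j hij => ⟨key i j hij, key j i (hsymm i j hij)⟩)
    refine ⟨A, B, hAB, hcost.trans ?_⟩
    rw [← Finset.sum_div, hq1]; exact hcase.le

lemma tl_card_interedges {V : Type*} [DecidableEq V] (G : SimpleGraph V)
    [DecidableRel G.Adj] (X Y : Finset V) :
    (G.interedges X Y).card = ∑ x ∈ X, (Y.filter fun y => G.Adj x y).card := by
  simp only [SimpleGraph.interedges, Rel.interedges, Finset.card_filter, Finset.sum_product]

lemma tl_kst (s t : ℕ) (d : ℝ) (hd : 0 < d) : ∃ M : ℕ, 
    ∀ (n : ℕ) (G : SimpleGraph (Fin n)) [DecidableRel G.Adj] (X Y : Finset (Fin n)), 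
      M ≤ X.card → M ≤ Y.card →
      d * X.card * Y.card ≤ (G.interedges X Y).card →
      ∃ S ⊆ X, ∃ T ⊆ Y, S.card = s ∧ T.card = t ∧ ∀ x ∈ S, ∀ y ∈ T, G.Adj x y := by
  classical
  obtain ⟨M0, hM0⟩ := exists_nat_ge (4 * (s + 1) / d)
  rw [div_le_iff₀ hd] at hM0
  obtain ⟨M, hM⟩ := exists_nat_ge (2 * M0 / d + 4 * (2 ^ M0 * (t + 1)) / d + 1)
  have hM0' : (0:ℝ) < M0 := by
    by_contra! hcon
    have : (0:ℝ) ≤ s := by positivity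
    nlinarith
  have g1 : 0 ≤ 2 * M0 / d := by positivity
  have g2 : 0 ≤ 4 * (2 ^ M0 * ((t:ℝ) + 1)) / d := by positivity
  have hMa : 2 * M0 / d ≤ M := by linarith
  have hMb : 4 * (2 ^ M0 * ((t:ℝ) + 1)) / d ≤ M := by linarith
  have hMc : (1:ℝ) ≤ M := by linarith
  rw [div_le_iff₀ hd] at hMa hMb
  refine ⟨M, fun n G _ X Y hX hY hE => ?_⟩
  have hX' : (M:ℝ) ≤ X.card := by exact_mod_cast hX
  have hY' : (M:ℝ) ≤ Y.card := by exact_mod_cast hY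
  have hYpos : (0:ℝ) < Y.card := by linarith
  rw [tl_card_interedges] at hE
  push_cast at hE
  set X1 := X.filter fun x => d / 2 * Y.card ≤ ((Y.filter fun y => G.Adj x y).card : ℝ) with hX1
  have hX1card : (M0:ℝ) ≤ X1.card := by
    have : ∑ x ∈ X, ((Y.filter fun y => G.Adj x y).card : ℝ) ≤
        ∑ x ∈ X, ((if d / 2 * Y.card ≤ ((Y.filter fun y => G.Adj x y).card : ℝ) then
          (Y.card : ℝ) else 0) + d / 2 * Y.card) := by
      refine Finset.sum_le_sum fun x _ => ?_
      have h1 : ((Y.filter fun y => G.Adj x y).card : ℝ) ≤ Y.card := by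
        exact_mod_cast Finset.card_filter_le _ _
      split_ifs with h
      · have : 0 ≤ d / 2 * Y.card := by positivity
        linarith
      · linarith
    rw [Finset.sum_add_distrib, ← Finset.sum_filter, Finset.sum_const, Finset.sum_const] at this
    simp only [nsmul_eq_mul] at this
    have h2 : (d / 2 * X.card) * Y.card ≤ X1.card * Y.card := by linarith
    have h3 := le_of_mul_le_mul_right h2 hYpos
    nlinarith
  obtain ⟨X0, hX0, hX0card⟩ := Finset.exists_subset_card_eq (show M0 ≤ X1.card by exact_mod_cast hX1card)
  set Y1 := Y.filter fun y => s ≤ (X0.filter fun x => G.Adj x y).card with hY1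
  have hY1card : d / 4 * Y.card ≤ Y1.card := by
    have h1 : d / 2 * Y.card * M0 ≤ ∑ x ∈ X0, ((Y.filter fun y => G.Adj x y).card : ℝ) := by
      have : ∑ x ∈ X0, (d / 2 * Y.card) ≤ ∑ x ∈ X0, ((Y.filter fun y => G.Adj x y).card : ℝ) :=
        Finset.sum_le_sum fun x hx => (Finset.mem_filter.1 (hX0 hx)).2
      rw [Finset.sum_const, hX0card, nsmul_eq_mul] at this
      linarith
    have h2 : ∑ x ∈ X0, ((Y.filter fun y => G.Adj x y).card : ℝ) =
        ∑ y ∈ Y, ((X0.filter fun x => G.Adj x y).card : ℝ) := by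
      simp only [Finset.card_filter]
      push_cast
      exact Finset.sum_comm
    have h3 : ∑ y ∈ Y, ((X0.filter fun x => G.Adj x y).card : ℝ) ≤
        ∑ y ∈ Y, ((if s ≤ (X0.filter fun x => G.Adj x y).card then (M0:ℝ) else 0) + s) := by
      refine Finset.sum_le_sum fun y _ => ?_
      have h1 : ((X0.filter fun x => G.Adj x y).card : ℝ) ≤ M0 := by
        rw [← hX0card]; exact_mod_cast Finset.card_filter_le _ _
      split_ifs with h
      · have : (0:ℝ) ≤ s := by positivity
        linarith
      · push Not at h
        have : ((X0.filter fun x => G.Adj x y).card : ℝ) ≤ s := by exact_mod_cast h.le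
        linarith
    rw [Finset.sum_add_distrib, ← Finset.sum_filter, Finset.sum_const, Finset.sum_const] at h3
    simp only [nsmul_eq_mul] at h3
    rw [h2] at h1
    have h4 : d / 2 * Y.card * M0 ≤ Y1.card * M0 + Y.card * s := h1.trans h3
    have h5 : (Y.card : ℝ) * s ≤ d / 4 * Y.card * M0 := by nlinarith
    have h6 : (d / 4 * Y.card) * M0 ≤ Y1.card * M0 := by linarith
    exact le_of_mul_le_mul_right h6 hM0'
  have hch : ∀ y ∈ Y1, ∃ S ⊆ X0.filter (fun x => G.Adj x y), S.card = s := fun y hy =>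
    Finset.exists_subset_card_eq (Finset.mem_filter.1 hy).2
  choose! F hF1 hF2 using hch
  have hbig : X0.powerset.card * t < Y1.card := by
    rw [Finset.card_powerset, hX0card]
    have : (((2 ^ M0 * t : ℕ)) : ℝ) < Y1.card := by
      push_cast
      have hp : (0:ℝ) < 2 ^ M0 := by positivity
      nlinarith
    exact_mod_cast this
  obtain ⟨S, hS, hT⟩ := Finset.exists_lt_card_fiber_of_mul_lt_card_of_maps_to (f := F)
    (fun y hy => Finset.mem_powerset.2 ((hF1 y hy).trans (Finset.filter_subset _ _))) hbig
  obtain ⟨T, hT1, hT2⟩ := Finset.exists_subset_card_eq hT.le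
  refine ⟨S, (Finset.mem_powerset.1 hS).trans (hX0.trans (Finset.filter_subset _ _)), T,
    hT1.trans ((Finset.filter_subset _ _).trans (Finset.filter_subset _ _)), ?_, hT2, ?_⟩
  · obtain ⟨y, hy⟩ := Finset.card_pos.1 (lt_of_le_of_lt (Nat.zero_le _) hT)
    rw [Finset.mem_filter] at hy
    rw [← hy.2]; exact hF2 y hy.1
  · intro x hx y hy
    have hy' := Finset.mem_filter.1 (hT1 hy)
    rw [← hy'.2] at hx
    exact (Finset.mem_filter.1 (hF1 y hy'.1 hx)).2

lemma tl_embed {VH V : Type*} [Fintype VH] [DecidableEq V] (H : SimpleGraph VH) (G : SimpleGraph V)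
    (b : VH → Bool) (hb : ∀ u v, H.Adj u v → b u ≠ b v) (S T : Finset V)
    (hS : S.card = (Finset.univ.filter fun v => b v = true).card)
    (hT : T.card = (Finset.univ.filter fun v => b v = false).card)
    (hdisj : Disjoint S T) (hG : ∀ x ∈ S, ∀ y ∈ T, G.Adj x y) :
    ∃ φ : VH → V, Function.Injective φ ∧ (∀ u v, H.Adj u v → G.Adj (φ u) (φ v)) ∧
      (∀ v, b v = true → φ v ∈ S) ∧ (∀ v, b v = false → φ v ∈ T) := by
  classical
  let e1 := Finset.equivOfCardEq hS.symm
  let e2 := Finset.equivOfCardEq hT.symm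
  let φ : VH → V := fun v => if h : b v = true then (e1 ⟨v, by simpa using h⟩ : V)
    else (e2 ⟨v, by simpa using h⟩ : V)
  have h1 : ∀ v, b v = true → φ v ∈ S := by
    intro v hv; simp [φ, hv]
  have h2 : ∀ v, b v = false → φ v ∈ T := by
    intro v hv; simp [φ, hv]
  refine ⟨φ, ?_, ?_, h1, h2⟩
  · intro u v huv
    cases hu : b u <;> cases hv : b v
    · simp only [φ, hu, hv] at huv
      simp at huv
      simpa using huv
    · exact (Finset.disjoint_left.1 hdisj (h1 v hv) (huv ▸ h2 u hu)).elim
    · exact (Finset.disjoint_left.1 hdisj (h1 u hu) (huv ▸ h2 v hv)).elim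
    · simp only [φ, hu, hv] at huv
      simp at huv
      simpa using huv
  · intro u v huv
    have := hb u v huv
    cases hu : b u <;> cases hv : b v
    · simp_all
    · exact (hG _ (h1 v hv) _ (h2 u hu)).symm
    · exact hG _ (h1 u hu) _ (h2 v hv)
    · simp_all

lemma tl_greedy {VH V ι : Type*} [Fintype VH] [DecidableEq V] [DecidableEq ι]
    (H : SimpleGraph VH) (G : SimpleGraph V)
    (b : VH → Bool) (s t : ℕ)
    (hs : s = (Finset.univ.filter fun v => b v = true).card)
    (ht : t = (Finset.univ.filter fun v => b v = false).card)
    (P : ι → Finset V) (hP : ∀ i j x, x ∈ P i → x ∈ P j → i = j)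
    (r : ι → ι → Prop) (η : ℝ)
    (hK : ∀ i j, r i j → ∀ X ⊆ P i, ∀ Y ⊆ P j, η * (P i).card ≤ X.card → η * (P j).card ≤ Y.card →
      ∃ φ : VH → V, Function.Injective φ ∧ (∀ u v, H.Adj u v → G.Adj (φ u) (φ v)) ∧
      (∀ v, b v = true → φ v ∈ X) ∧ (∀ v, b v = false → φ v ∈ Y))
    (M : Multiset {e : ι × ι // r e.1 e.2}) :
    (∀ l, (((M.map fun e => tlLoad s t l e.1).sum : ℕ) : ℝ) ≤ (1 - η) * (P l).card) →
    ∃ f : Fin M.card → VH → V,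
      ((∀ i, Function.Injective (f i)) ∧
      (∀ i u v, H.Adj u v → G.Adj (f i u) (f i v)) ∧
      (∀ i j, i ≠ j → ∀ u v, f i u ≠ f j v)) ∧
      ∃ U : Finset V, (∀ i u, f i u ∈ U) ∧
        ∀ l, (U ∩ P l).card ≤ (M.map fun e => tlLoad s t l e.1).sum := by
  classical
  induction M using Multiset.induction with
  | empty =>
    intro _
    refine ⟨fun i => i.elim0, ⟨fun i => i.elim0, fun i => i.elim0, fun i => i.elim0⟩, ∅,
      fun i => i.elim0, by simp⟩
  | cons e M ih =>
    intro hload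
    obtain ⟨f, ⟨hf1, hf2, hf3⟩, U, hU1, hU2⟩ := ih (fun l => by
      refine le_trans ?_ (hload l)
      rw [Multiset.map_cons, Multiset.sum_cons]
      push_cast
      have : (0:ℝ) ≤ (tlLoad s t l e.1 : ℝ) := by positivity
      linarith)
    have hfree : ∀ l, η * (P l).card ≤ (P l \ U).card := by
      intro l
      have h1 : (P l \ U).card + (U ∩ P l).card = (P l).card := by
        rw [Finset.inter_comm]; exact Finset.card_sdiff_add_card_inter _ _
      have h2 := hload l
      rw [Multiset.map_cons, Multiset.sum_cons] at h2
      push_cast at h2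
      have h3 : (0:ℝ) ≤ (tlLoad s t l e.1 : ℝ) := by positivity
      have h4 : ((U ∩ P l).card : ℝ) ≤ ((M.map fun e => tlLoad s t l e.1).sum : ℕ) := by
        exact_mod_cast hU2 l
      have h5 : ((P l \ U).card : ℝ) + (U ∩ P l).card = (P l).card := by exact_mod_cast h1
      push_cast at h4
      linarith
    obtain ⟨φ, hφ1, hφ2, hφ3, hφ4⟩ := hK e.1.1 e.1.2 e.2 (P e.1.1 \ U) Finset.sdiff_subset
      (P e.1.2 \ U) Finset.sdiff_subset (hfree _) (hfree _)
    have hφU : ∀ v, φ v ∉ U := by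
      intro v
      cases hv : b v
      · exact (Finset.mem_sdiff.1 (hφ4 v hv)).2
      · exact (Finset.mem_sdiff.1 (hφ3 v hv)).2
    have main : ∃ f : Fin (M.card + 1) → VH → V,
      ((∀ i, Function.Injective (f i)) ∧
      (∀ i u v, H.Adj u v → G.Adj (f i u) (f i v)) ∧
      (∀ i j, i ≠ j → ∀ u v, f i u ≠ f j v)) ∧
      ∃ U : Finset V, (∀ i u, f i u ∈ U) ∧
        ∀ l, (U ∩ P l).card ≤ ((e ::ₘ M).map fun e => tlLoad s t l e.1).sum := by
      refine ⟨Fin.cons φ f, ⟨?_, ?_, ?_⟩, U ∪ Finset.univ.image φ, ?_, ?_⟩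
      · intro i
        refine Fin.cases ?_ (fun i => ?_) i
        · simpa using hφ1
        · simpa using hf1 i
      · intro i
        refine Fin.cases ?_ (fun i => ?_) i
        · simpa using hφ2
        · simpa using hf2 i
      · intro i j
        refine Fin.cases ?_ (fun i => ?_) i <;> refine Fin.cases ?_ (fun j => ?_) j
        · simp
        · intro _ u v h
          simp only [Fin.cons_zero, Fin.cons_succ] at h
          exact hφU u (h ▸ hU1 j v)
        · intro _ u v h
          simp only [Fin.cons_zero, Fin.cons_succ] at h
          exact hφU v (h ▸ hU1 i u)
        · intro hij u v
          simpa using hf3 i j (fun h => hij (by rw [h])) u v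
      · intro i
        refine Fin.cases ?_ (fun i => ?_) i
        · intro u; simp
        · intro u; simp [hU1 i u]
      · intro l
        rw [Multiset.map_cons, Multiset.sum_cons, Finset.union_inter_distrib_right, add_comm]
        refine (Finset.card_union_le _ _).trans (add_le_add (hU2 l) ?_)
        have h1 : (Finset.univ.image φ) ∩ P l ⊆
            (Finset.univ.filter fun v => φ v ∈ P l).image φ := by
          intro x
          simp only [Finset.mem_inter, Finset.mem_image, Finset.mem_univ, true_and,
            Finset.mem_filter]
          rintro ⟨⟨v, rfl⟩, hx⟩
          exact ⟨v, hx, rfl⟩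
        refine (Finset.card_le_card h1).trans (Finset.card_image_le.trans ?_)
        have h2 : (Finset.univ.filter fun v => φ v ∈ P l) ⊆
            (if l = e.1.1 then Finset.univ.filter fun v => b v = true else ∅) ∪
            (if l = e.1.2 then Finset.univ.filter fun v => b v = false else ∅) := by
          intro v hv
          simp only [Finset.mem_filter, Finset.mem_univ, true_and] at hv
          cases hbv : b v
          · have := hP _ _ _ hv (Finset.mem_sdiff.1 (hφ4 v hbv)).1
            simp [this, hbv]
          · have := hP _ _ _ hv (Finset.mem_sdiff.1 (hφ3 v hbv)).1
            simp [this, hbv]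
        refine (Finset.card_le_card h2).trans ((Finset.card_union_le _ _).trans ?_)
        unfold tlLoad
        gcongr
        · split_ifs <;> simp [hs]
        · split_ifs <;> simp [ht]
    rw [Multiset.card_cons]
    exact main

lemma tl_tiling {VH V ι : Type*} [Fintype VH] [DecidableEq V] [DecidableEq ι] [Fintype ι]
    (H : SimpleGraph VH) (G : SimpleGraph V)
    (b : VH → Bool) (s t : ℕ)
    (hs : s = (Finset.univ.filter fun v => b v = true).card)
    (ht : t = (Finset.univ.filter fun v => b v = false).card)
    (P : ι → Finset V) (hP : ∀ i j x, x ∈ P i → x ∈ P j → i = j)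
    (r : ι → ι → Prop) [DecidableRel r] (η : ℝ) (hη1 : η ≤ 1)
    (hK : ∀ i j, r i j → ∀ X ⊆ P i, ∀ Y ⊆ P j, η * (P i).card ≤ X.card → η * (P j).card ≤ Y.card →
      ∃ φ : VH → V, Function.Injective φ ∧ (∀ u v, H.Adj u v → G.Adj (φ u) (φ v)) ∧
      (∀ v, b v = true → φ v ∈ X) ∧ (∀ v, b v = false → φ v ∈ Y))
    (m : ℕ) (hm : ∀ l, m ≤ (P l).card) (Θ : ℝ)
    (w : {e : ι × ι // r e.1 e.2} → ℝ) (hw : ∀ e, 0 ≤ w e)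
    (hwl : ∀ l, ∑ e, w e * (tlLoad s t l e.1 : ℝ) ≤ 1) (hwΘ : Θ ≤ ∑ e, w e)
    (K : ℕ) (hKle : (K : ℝ) ≤ (1 - η) * m * Θ - (Fintype.card ι : ℝ) ^ 2) :
    HasTiling H G K := by
  classical
  let N : {e : ι × ι // r e.1 e.2} → ℕ := fun e => ⌊(1 - η) * m * w e⌋₊
  have hη' : 0 ≤ (1 - η) * m := mul_nonneg (by linarith) (by positivity)
  let M : Multiset {e : ι × ι // r e.1 e.2} := ∑ e, N e • {e}
  have hMcard : M.card = ∑ e, N e := by simp [M]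
  have hMmap : ∀ l, (M.map fun e => tlLoad s t l e.1).sum = ∑ e, N e * tlLoad s t l e.1 := by
    intro l
    let hom : Multiset {e : ι × ι // r e.1 e.2} →+ ℕ := (Multiset.sumAddMonoidHom).comp
      (Multiset.mapAddMonoidHom fun e : {e : ι × ι // r e.1 e.2} => tlLoad s t l e.1)
    have h1 : (M.map fun e => tlLoad s t l e.1).sum = hom M := rfl
    rw [h1, map_sum]
    refine Finset.sum_congr rfl fun e _ => ?_
    rw [map_nsmul, smul_eq_mul]
    simp [hom]
  obtain ⟨f, ⟨hf1, hf2, hf3⟩, -⟩ := tl_greedy H G b s t hs ht P hP r η hK M (by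
    intro l
    rw [hMmap]
    push_cast
    have h1 : ∑ e, (N e : ℝ) * (tlLoad s t l e.1 : ℝ) ≤
        ∑ e, (1 - η) * m * (w e * (tlLoad s t l e.1 : ℝ)) := by
      refine Finset.sum_le_sum fun e _ => ?_
      have h2 : (N e : ℝ) ≤ (1 - η) * m * w e := Nat.floor_le (mul_nonneg hη' (hw e))
      rw [← mul_assoc]
      gcongr
    rw [← Finset.mul_sum] at h1
    have h3 : (m : ℝ) ≤ (P l).card := by exact_mod_cast hm l
    have h4 := mul_le_mul_of_nonneg_left (hwl l) hη'
    have h5 := mul_le_mul_of_nonneg_left h3 (by linarith : 0 ≤ 1 - η)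
    linarith)
  have hle : K ≤ M.card := by
    rw [hMcard]
    have h1 : ∑ e, ((1 - η) * m * w e - 1) ≤ ∑ e, (N e : ℝ) :=
      Finset.sum_le_sum fun e _ => (Nat.sub_one_lt_floor _).le
    rw [Finset.sum_sub_distrib, ← Finset.mul_sum] at h1
    simp only [Finset.sum_const, nsmul_eq_mul, mul_one, Finset.card_univ] at h1
    have h2 : (Fintype.card {e : ι × ι // r e.1 e.2} : ℝ) ≤ (Fintype.card ι : ℝ) ^ 2 := by
      have := Fintype.card_subtype_le (fun e : ι × ι => r e.1 e.2)
      rw [Fintype.card_prod] at this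
      rw [sq]; exact_mod_cast this
    have h3 := mul_le_mul_of_nonneg_left hwΘ hη'
    have h4 : (K : ℝ) ≤ ((∑ e, N e : ℕ) : ℝ) := by push_cast; linarith
    exact_mod_cast h4
  exact ⟨fun i => f (Fin.castLE hle i), fun i => hf1 _, fun i => hf2 _, fun i j hij =>
    hf3 _ _ (fun h => hij (Fin.castLE_injective hle h))⟩

lemma tl_edge_count {n : ℕ} (G : SimpleGraph (Fin n)) [DecidableRel G.Adj]
    (UA UB : Finset (Fin n))
    (h : ∀ x y, G.Adj x y → x ∈ UA ∨ y ∈ UA ∨ (x ∈ UB ∧ y ∈ UB)) :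
    2 * (G.edgeFinset.card : ℝ) ≤ 2 * n * UA.card - (UA.card : ℝ) ^ 2 + (UB.card : ℝ) ^ 2 := by
  classical
  have h0 := G.two_mul_card_edgeFinset
  have h1 : (Finset.univ.filter fun (x, y) => G.Adj x y) ⊆
      (Finset.univ \ (UAᶜ ×ˢ UAᶜ)) ∪ UB ×ˢ UB := by
    rintro ⟨x, y⟩ hxy
    simp only [Finset.mem_filter, Finset.mem_univ, true_and] at hxy
    have := h x y hxy
    simp only [Finset.mem_union, Finset.mem_sdiff, Finset.mem_univ, true_and, Finset.mem_product,
      Finset.mem_compl]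
    tauto
  have h2 := (Finset.card_le_card h1).trans (Finset.card_union_le _ _)
  rw [← h0] at h2
  have h3 := Finset.card_sdiff_add_card_eq_card (Finset.subset_univ (UAᶜ ×ˢ UAᶜ))
  simp only [Finset.card_product, Finset.card_univ, Fintype.card_prod, Fintype.card_fin] at h2 h3
  have h4 : UA.card + UAᶜ.card = n := by simp
  have h2' : 2 * (G.edgeFinset.card : ℝ) ≤ ((Finset.univ \ (UAᶜ ×ˢ UAᶜ)).card : ℝ) +
    UB.card * UB.card := by exact_mod_cast h2
  have h3' : ((Finset.univ \ (UAᶜ ×ˢ UAᶜ)).card : ℝ) + UAᶜ.card * UAᶜ.card = n * n := by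
    exact_mod_cast h3
  have h4' : (UA.card : ℝ) + UAᶜ.card = n := by exact_mod_cast h4
  have h5 : (UAᶜ.card : ℝ) = n - UA.card := by linarith
  rw [h5] at h3'
  nlinarith

set_option maxHeartbeats 1000000 in
/-- The heart of the proof: regularity plus the dichotomy. -/
lemma tl_core {VH : Type*} [Fintype VH] (H : SimpleGraph VH)
    (b : VH → Bool) (hb : ∀ u v, H.Adj u v → b u ≠ b v)
    (s t : ℕ)
    (hs : s = (Finset.univ.filter fun v => b v = true).card)
    (ht : t = (Finset.univ.filter fun v => b v = false).card)
    (hs0 : 0 < s) (ht0 : 0 < t) (β δ ε : ℝ) (hβ : 0 < β) (hδ : 0 < δ) (hε : 0 < ε) (hε1 : ε ≤ 1)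
    (hεδ : ε / 8 * (β + δ) ≤ δ / 2) :
    ∃ n₀ : ℕ, ∀ n : ℕ, n₀ ≤ n → ∀ G : SimpleGraph (Fin n),
      ¬ HasTiling H G ⌈β * (n : ℝ)⌉₊ →
      ∃ a c : ℝ, 0 ≤ a ∧ 0 ≤ c ∧ a / s + c / (s + t) ≤ (β + 2 * δ) * n ∧
      2 * (G.edgeSet.ncard : ℝ) ≤ 2 * n * a - a ^ 2 + c ^ 2 + 2 * ε * n ^ 2 := by
  classical
  obtain ⟨M, hM⟩ := tl_kst s t (ε / 8) (by positivity)
  set B := SzemerediRegularity.bound (ε / 8) ⌈4 / ε⌉₊ with hB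
  obtain ⟨n₁, hn₁⟩ := exists_nat_ge
    (((β + δ) * B + B ^ 2 + 1) / (δ / 2) + (β + δ) * B / δ + (8 * M / ε + 1) * B + ⌈4 / ε⌉₊ + 1)
  have hβδ : 0 < β + δ := by positivity
  refine ⟨n₁, fun n hn G hG => ?_⟩
  have hn' : (n₁ : ℝ) ≤ n := by exact_mod_cast hn
  have p1 : 0 ≤ ((β + δ) * B + B ^ 2 + 1) / (δ / 2) := by positivity
  have p2 : 0 ≤ (β + δ) * B / δ := by positivity
  have p3 : 0 ≤ (8 * M / ε + 1) * B := by positivity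
  have p4 : (0:ℝ) ≤ ⌈4 / ε⌉₊ := by positivity
  have q1 : ((β + δ) * B + B ^ 2 + 1) / (δ / 2) ≤ n := by linarith
  have q2 : (β + δ) * B / δ ≤ n := by linarith
  have q3 : (8 * M / ε + 1) * B ≤ n := by linarith
  have q4 : ((⌈4 / ε⌉₊ : ℕ) : ℝ) ≤ n := by linarith
  have q5 : (1:ℝ) ≤ n := by linarith
  rw [div_le_iff₀ (by positivity)] at q1 q2
  have hnpos : 0 < n := by exact_mod_cast (by linarith : (0:ℝ) < n)
  have : Nonempty (Fin n) := ⟨⟨0, hnpos⟩⟩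
  obtain ⟨P, hP1, hP2, hP3, hP4⟩ := szemeredi_regularity G (ε := ε / 8) (l := ⌈4 / ε⌉₊)
    (by positivity) (by rw [Fintype.card_fin]; exact_mod_cast q4)
  rw [← hB] at hP3
  have hk4 : 4 / ε ≤ P.parts.card := (Nat.le_ceil _).trans (by exact_mod_cast hP2)
  set k := P.parts.card with hk
  have hkpos : 0 < k := by
    have : (0:ℝ) < k := lt_of_lt_of_le (by positivity) hk4
    exact_mod_cast this
  have hkpos' : (0:ℝ) < k := by exact_mod_cast hkpos
  have hkB : (k : ℝ) ≤ B := by exact_mod_cast hP3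
  have hred := SimpleGraph.regularityReduced_edges_card_aux (G := G) hε hP1 hP4 hk4
  set G' := G.regularityReduced P (ε / 8) (ε / 4) with hG'
  let r : P.parts → P.parts → Prop := fun U W => U ≠ W ∧ G.IsUniform (ε / 8) U.1 W.1 ∧
    ε / 4 ≤ G.edgeDensity U.1 W.1
  have hrsymm : ∀ i j, r i j → r j i := by
    rintro i j ⟨h1, h2, h3⟩
    exact ⟨h1.symm, h2.symm, by rwa [SimpleGraph.edgeDensity_comm]⟩
  set m := n / k with hm
  have hmk : (n : ℝ) ≤ m * k + k := by
    have := Nat.lt_div_mul_add (a := n) hkpos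
    exact_mod_cast this.le
  have hmk2 : (m : ℝ) * k ≤ n := by exact_mod_cast Nat.div_mul_le_self n k
  have hmU : ∀ U : P.parts, m ≤ U.1.card := by
    intro U
    have := hP1.average_le_card_part U.2
    simpa using this
  have hUm : ∀ U : P.parts, U.1.card ≤ m + 1 := by
    intro U
    have := hP1.card_part_le_average_add_one U.2
    simpa using this
  have hmM : 8 * M / ε ≤ m := by
    have : (8 * M / ε + 1) * k ≤ m * k + k :=
      le_trans (by gcongr) (q3.trans hmk)
    have : (8 * M / ε) * k ≤ m * k := by linarith
    exact le_of_mul_le_mul_right this hkpos'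
  rw [div_le_iff₀ hε] at hmM
  rcases tl_dichotomy r hrsymm s t hs0 ht0 ((β + δ) * k) (by positivity) with
    ⟨w, hw, hwl, hwΘ⟩ | ⟨A, C, hAC, hcost⟩
  · exfalso
    apply hG
    refine tl_tiling H G b s t hs ht (fun U : P.parts => U.1) ?_ r (ε / 8) (by linarith) ?_ m hmU
      ((β + δ) * k) w hw hwl hwΘ _ ?_
    · intro i j x hi hj
      by_contra hij
      exact Finset.disjoint_left.1 (P.disjoint i.2 j.2 (fun h => hij (Subtype.ext h))) hi hj
    · rintro i j ⟨hij, hu, hd⟩ X hX Y hY hXc hYc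
      have hdisj : Disjoint X Y :=
        (P.disjoint i.2 j.2 (fun h => hij (Subtype.ext h))).mono hX hY
      have big : ∀ (U : P.parts) (Z : Finset (Fin n)), ε / 8 * U.1.card ≤ Z.card → M ≤ Z.card := by
        intro U Z hZ
        have h1 : (m : ℝ) ≤ U.1.card := by exact_mod_cast hmU U
        have : (M : ℝ) ≤ Z.card := by nlinarith
        exact_mod_cast this
      have hXM := big i X hXc
      have hYM := big j Y hYc
      have hun := hu hX hY (by linarith) (by linarith)
      rw [abs_lt] at hun
      have hdens : ε / 8 ≤ (G.edgeDensity X Y : ℝ) := by linarith [hun.1]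
      have hcardE : ε / 8 * X.card * Y.card ≤ (G.interedges X Y).card := by
        rw [SimpleGraph.edgeDensity_def] at hdens
        push_cast at hdens
        by_cases h0 : (0:ℝ) < X.card * Y.card
        · rw [le_div_iff₀ h0] at hdens
          linarith
        · have : (X.card : ℝ) * Y.card = 0 := le_antisymm (not_lt.1 h0) (by positivity)
          rw [mul_assoc, this]; simp
      obtain ⟨S, hS, T, hT, hSc, hTc, hST⟩ := hM n G X Y hXM hYM hcardE
      obtain ⟨φ, h1, h2, h3, h4⟩ := tl_embed H G b hb S T (hSc.trans hs) (hTc.trans ht)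
        (hdisj.mono hS hT) hST
      exact ⟨φ, h1, h2, fun v hv => hS (h3 v hv), fun v hv => hT (h4 v hv)⟩
    · have hceil : ((⌈β * (n:ℝ)⌉₊ : ℕ) : ℝ) ≤ β * n + 1 :=
        (Nat.ceil_lt_add_one (by positivity)).le
      refine hceil.trans ?_
      rw [Fintype.card_coe, ← hk]
      have e1 : (1 - ε / 8) * m * ((β + δ) * k) = ((1 - ε / 8) * (β + δ)) * (m * k) := by ring
      rw [e1]
      have e2 : β + δ / 2 ≤ (1 - ε / 8) * (β + δ) := by linarith
      have e3 : (β + δ / 2) * (n - k) ≤ ((1 - ε / 8) * (β + δ)) * (m * k) := by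
        apply le_trans (mul_le_mul_of_nonneg_left (by linarith : (n:ℝ) - k ≤ m * k) (by positivity))
        exact mul_le_mul_of_nonneg_right e2 (by positivity)
      have e4 : (k:ℝ) ^ 2 ≤ B ^ 2 := by gcongr
      have e5 : (β + δ / 2) * k ≤ (β + δ) * B := by gcongr; linarith
      linarith
  · set UA := A.biUnion (fun U => U.1) with hUA
    set UC := C.biUnion (fun U => U.1) with hUC
    have hcardU : ∀ D : Finset P.parts, ((D.biUnion (fun U => U.1)).card : ℝ) ≤
        D.card * (m + 1) := by
      intro D
      have := Finset.card_biUnion_le_card_mul D (fun U : P.parts => U.1) (m + 1)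
        (fun U _ => hUm U)
      exact_mod_cast this
    have hedge := tl_edge_count G' UA UC (by
      rintro x y ⟨hxy, U, hU, W, hW, hxU, hyW, hUW, hun, hd⟩
      rcases hAC ⟨U, hU⟩ ⟨W, hW⟩ ⟨fun h => hUW (congrArg Subtype.val h), hun, hd⟩ with
        h | h | ⟨h, h'⟩
      · exact Or.inl (Finset.mem_biUnion.2 ⟨_, h, hxU⟩)
      · exact Or.inr (Or.inl (Finset.mem_biUnion.2 ⟨_, h, hyW⟩))
      · exact Or.inr (Or.inr ⟨Finset.mem_biUnion.2 ⟨_, h, hxU⟩, Finset.mem_biUnion.2 ⟨_, h', hyW⟩⟩))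
    have hs' : (0:ℝ) < s := by exact_mod_cast hs0
    have ht' : (0:ℝ) < t := by exact_mod_cast ht0
    refine ⟨UA.card, UC.card, by positivity, by positivity, ?_, ?_⟩
    · have h1 : (UA.card : ℝ) / s + UC.card / (s + t) ≤
          ((A.card : ℝ) / s + C.card / (s + t)) * (m + 1) := by
        rw [add_mul, div_mul_eq_mul_div, div_mul_eq_mul_div]
        gcongr
        · exact hcardU A
        · exact hcardU C
      have h2 : ((A.card : ℝ) / s + C.card / (s + t)) * (m + 1) ≤ (β + δ) * k * (m + 1) := by
        gcongr
      have h3 : (β + δ) * k * (m + 1) = (β + δ) * (m * k) + (β + δ) * k := by ring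
      have h4 : (β + δ) * (m * k) ≤ (β + δ) * n := by gcongr
      have h5 : (β + δ) * k ≤ (β + δ) * B := by gcongr
      linarith
    · have hcard : (G.edgeSet.ncard : ℝ) = G.edgeFinset.card := by
        rw [← SimpleGraph.coe_edgeFinset, Set.ncard_coe_finset]
      rw [hcard]
      rw [Fintype.card_fin] at hred
      push_cast at hred
      linarith

set_option maxHeartbeats 1000000 in
/-- Let `H` be a bipartite graph with no isolated vertices, with a proper
2-coloring `b` minimizing the size `s` of the first color class (`t` being the
size of the second one).  For every `ε' > 0` and `β ∈ (0, 1/(s+t))`, for all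
sufficiently large `n`, every `n`-vertex graph containing no `⌈βn⌉` pairwise
vertex-disjoint copies of `H` has at most `T_{s,t}(β(s+t))·C(n,2) + ε'n²`
edges; i.e. `ex(n, ⌈βn⌉ × H) ≤ T_{s,t}(β(s+t))·C(n,2) + ε'n²`. -/
theorem ex_upper_bound {VH : Type*} [Fintype VH] (H : SimpleGraph VH)
    (hiso : ∀ v : VH, ∃ u, H.Adj v u)
    (b : VH → Bool) (hb : ∀ u v, H.Adj u v → b u ≠ b v)
    (hmin : ∀ c : VH → Bool, (∀ u v, H.Adj u v → c u ≠ c v) →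
      (Finset.univ.filter fun v => b v = true).card ≤
        (Finset.univ.filter fun v => c v = true).card)
    (s t : ℕ)
    (hs : s = (Finset.univ.filter fun v => b v = true).card)
    (ht : t = (Finset.univ.filter fun v => b v = false).card)
    (ε' : ℝ) (hε' : 0 < ε')
    (β : ℝ) (hβ : 0 < β) (hβ' : β < 1 / ((s : ℝ) + (t : ℝ))) :
    ∃ n₀ : ℕ, ∀ n : ℕ, n₀ ≤ n → ∀ G : SimpleGraph (Fin n),
      ¬ HasTiling H G ⌈β * (n : ℝ)⌉₊ →
      (G.edgeSet.ncard : ℝ) ≤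
        Tst s t (β * ((s : ℝ) + (t : ℝ))) * (n.choose 2 : ℝ) + ε' * (n : ℝ) ^ 2 := by
  classical
  have hne : Nonempty VH := by
    by_contra hcon
    rw [not_nonempty_iff] at hcon
    have h1 : s = 0 := by rw [hs]; simp
    have h2 : t = 0 := by rw [ht]; simp
    rw [h1, h2] at hβ'
    simp at hβ'
    linarith
  have hst0 : 0 < s ∧ 0 < t := by
    obtain ⟨v⟩ := hne
    obtain ⟨u, hu⟩ := hiso v
    have := hb v u hu
    rw [hs, ht, Finset.card_pos, Finset.card_pos]
    cases hv : b v <;> cases hu : b u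
    · simp_all
    · exact ⟨⟨u, by simp [hu]⟩, ⟨v, by simp [hv]⟩⟩
    · exact ⟨⟨v, by simp [hv]⟩, ⟨u, by simp [hu]⟩⟩
    · simp_all
  obtain ⟨hs0, ht0⟩ := hst0
  have hs' : (0:ℝ) < s := by exact_mod_cast hs0
  have ht' : (0:ℝ) < t := by exact_mod_cast ht0
  have hst : (0:ℝ) < s + t := by positivity
  rw [lt_div_iff₀ hst] at hβ'
  obtain ⟨δ, hδ, hδ1, hδ2⟩ : ∃ δ : ℝ, 0 < δ ∧ 16 * (s + t) * δ ≤ ε' ∧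
      (β + 2 * δ) * (s + t) ≤ 1 := by
    refine ⟨min (ε' / (16 * (s + t))) ((1 - β * (s + t)) / (2 * (s + t))), ?_, ?_, ?_⟩
    · apply lt_min
      · positivity
      · apply div_pos <;> linarith
    · have := min_le_left (ε' / (16 * ((s:ℝ) + t))) ((1 - β * (s + t)) / (2 * (s + t)))
      rw [le_div_iff₀ (by positivity)] at this
      linarith
    · have := min_le_right (ε' / (16 * ((s:ℝ) + t))) ((1 - β * (s + t)) / (2 * (s + t)))
      rw [le_div_iff₀ (by positivity)] at this
      linarith
  obtain ⟨ε, hε, hε1, hε2, hε3⟩ : ∃ ε : ℝ, 0 < ε ∧ ε ≤ 1 ∧ ε ≤ ε' / 4 ∧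
      ε / 8 * (β + δ) ≤ δ / 2 := by
    refine ⟨min (min 1 (ε' / 4)) (4 * δ / (β + δ)), ?_, ?_, ?_, ?_⟩
    · have : 0 < 4 * δ / (β + δ) := by positivity
      exact lt_min (lt_min one_pos (by positivity)) this
    · exact (min_le_left _ _).trans (min_le_left _ _)
    · exact (min_le_left _ _).trans (min_le_right _ _)
    · have := min_le_right (min 1 (ε' / 4)) (4 * δ / (β + δ))
      rw [le_div_iff₀ (by positivity)] at this
      linarith
  obtain ⟨n₁, hn₁⟩ := tl_core H b hb s t hs ht hs0 ht0 β δ ε hβ hδ hε hε1 hε3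
  obtain ⟨n₂, hn₂⟩ := exists_nat_ge (1 / ε' + 1)
  refine ⟨max n₁ n₂, fun n hn G hG => ?_⟩
  obtain ⟨a, c, ha, hc, hcost, hedge⟩ := hn₁ n ((le_max_left _ _).trans hn) G hG
  have hn2 : 1 / ε' + 1 ≤ n := hn₂.trans (by exact_mod_cast (le_max_right _ _).trans hn)
  have hinv : 0 < 1 / ε' := by positivity
  have hn0 : (0:ℝ) < n := by linarith
  have hnε : 1 ≤ n * ε' := by
    have : 1 / ε' ≤ n := by linarith
    rwa [div_le_iff₀ hε'] at this
  set θ := β + 2 * δ with hθ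
  have hopt := tl_opt (a / n) (c / n) s t θ hs' ht' (by positivity) (by positivity)
    (by nlinarith) (by positivity) (by
      have : a / n / s + c / n / (s + t) = (a / s + c / (s + t)) / n := by
        field_simp
      rw [this, div_le_iff₀ hn0]
      exact hcost)
  set T := Tst s t (β * ((s : ℝ) + (t : ℝ))) with hT
  have hTeq : T = max (2 * s * β - s ^ 2 * β ^ 2) ((s + t) ^ 2 * β ^ 2) := by
    rw [hT, Tst]
    congr 1
    · field_simp
    · ring
  have hT1 : T ≤ 1 := by
    rw [hTeq]
    apply max_le
    · nlinarith [sq_nonneg (1 - s * β)]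
    · have : 0 ≤ β * (s + t) := by positivity
      nlinarith
  have hTa : 2 * s * β - s ^ 2 * β ^ 2 ≤ T := by rw [hTeq]; exact le_max_left _ _
  have hTb : (s + t) ^ 2 * β ^ 2 ≤ T := by rw [hTeq]; exact le_max_right _ _
  have hmax : max (2 * s * θ - s ^ 2 * θ ^ 2) ((s + t) ^ 2 * θ ^ 2) ≤ T + 8 * (s + t) * δ := by
    apply max_le
    · have h1 : 2 * s * θ - s ^ 2 * θ ^ 2 ≤ 2 * s * β - s ^ 2 * β ^ 2 + 4 * s * δ := by
        have e : 2 * s * θ - s ^ 2 * θ ^ 2 = 2 * s * β - s ^ 2 * β ^ 2 + 4 * s * δ -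
            (4 * (s ^ 2 * (β * δ)) + 4 * (s ^ 2 * δ ^ 2)) := by
          rw [hθ]; ring
        have : (0:ℝ) ≤ 4 * (s ^ 2 * (β * δ)) + 4 * (s ^ 2 * δ ^ 2) := by positivity
        rw [e]
        linarith
      have h2 : (0:ℝ) ≤ (s + 2 * t) * δ := by positivity
      linarith
    · have h1 : (s + t) ^ 2 * θ ^ 2 = (s + t) ^ 2 * β ^ 2 +
          2 * ((s + t) * δ) * ((β + θ) * (s + t)) := by
        rw [hθ]; ring
      have h2 : (β + θ) * (s + t) ≤ 2 := by
        rw [add_mul]; linarith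
      have h3 : 0 ≤ (s + t) * δ := by positivity
      have h4 := mul_le_mul_of_nonneg_left h2 h3
      linarith
  have hfin : 2 * n * a - a ^ 2 + c ^ 2 ≤ (T + 8 * (s + t) * δ) * n ^ 2 := by
    have e : 2 * n * a - a ^ 2 + c ^ 2 = (2 * (a / n) - (a / n) ^ 2 + (c / n) ^ 2) * n ^ 2 := by
      field_simp
    rw [e]
    have := hopt.trans hmax
    gcongr
  have hchoose : (n.choose 2 : ℝ) = n * (n - 1) / 2 := Nat.cast_choose_two ℝ n
  rw [hchoose]
  have f1 : 8 * (s + t) * δ * n ^ 2 ≤ ε' / 2 * n ^ 2 := by gcongr; linarith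
  have f2 : 2 * ε * n ^ 2 ≤ ε' / 2 * n ^ 2 := by gcongr; linarith
  have f3 : T * n ≤ n := by nlinarith
  have f4 : (n:ℝ) ≤ ε' * n ^ 2 := by nlinarith
  nlinarith
end
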